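/- arXiv:2407.03366 — 2 statements merged into one kernel-verified Lean document; each statement's English description precedes it below -/
import Mathlib

section
/- Let n ≥ 2, ρ = (n−1)/2, and let λ be either purely imaginary with nonnegative imaginary part or real with 0 < λ < ρ. The kernel Ψ_λ(z,w) = F_λ((1+[z, conj w])/2) is positive definite on Ξ × Ξ: for every m ∈ ℕ, every z₁,…,z_m ∈ Ξ and every c₁,…,c_m ∈ ℂ, the sum Σ_{i,j=1}^m c_i · conj(c_j) · F_λ((1+[z_i, conj z_j])/2) is a nonnegative real number. -/
open scoped BigOperators
open Filter Topology

noncomputable section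

/-- The Lorentzian bilinear form on `ℝ^{1+n}`. -/
def lformR (n : ℕ) (x y : Fin (n+1) → ℝ) : ℝ :=
  ∑ i, (if i = 0 then (-1 : ℝ) else 1) * x i * y i

/-- The complex-bilinear Lorentzian form on `ℂ^{1+n}`. -/
def lformC (n : ℕ) (z w : Fin (n+1) → ℂ) : ℂ :=
  ∑ i, (if i = 0 then (-1 : ℂ) else 1) * z i * w i

/-- The matrix `η = diag(−1,1,…,1)`. -/
def eta (n : ℕ) : Matrix (Fin (n+1)) (Fin (n+1)) ℝ :=
  Matrix.diagonal (fun i => if i = 0 then (-1 : ℝ) else 1)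

/-- Membership in `G = SO(1,n)_e`. -/
def memG (n : ℕ) (g : Matrix (Fin (n+1)) (Fin (n+1)) ℝ) : Prop :=
  g.transpose * eta n * g = eta n ∧ g.det = 1 ∧ 0 < g 0 0

/-- Standard basis vector `e₀`. -/
def e0 (n : ℕ) : Fin (n+1) → ℝ := fun i => if i = 0 then 1 else 0

/-- Standard basis vector `eₙ`. -/
def elast (n : ℕ) : Fin (n+1) → ℝ := fun i => if i = Fin.last n then 1 else 0

/-- Membership in `H = SO(1,n−1)_e`, the stabilizer of `eₙ`. -/
def memH (n : ℕ) (g : Matrix (Fin (n+1)) (Fin (n+1)) ℝ) : Prop :=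
  memG n g ∧ g.mulVec (elast n) = elast n

/-- Membership in `K = SO(n)`, the stabilizer of `e₀`. -/
def memK (n : ℕ) (g : Matrix (Fin (n+1)) (Fin (n+1)) ℝ) : Prop :=
  memG n g ∧ g.mulVec (e0 n) = e0 n

/-- The boost `a_t`. -/
def boost (n : ℕ) (t : ℝ) : Matrix (Fin (n+1)) (Fin (n+1)) ℝ :=
  Matrix.of fun i j =>
    if i = 0 ∧ j = 0 then Real.cosh t
    else if i = Fin.last n ∧ j = Fin.last n then Real.cosh t
    else if (i = 0 ∧ j = Fin.last n) ∨ (i = Fin.last n ∧ j = 0) then Real.sinh t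
    else if i = j then 1 else 0

/-- The upper hemisphere `S^n_+ = {(ix₀, 𝐱) : x₀ > 0, x₀² + |𝐱|² = 1}` in `ℂ^{1+n}`. -/
def Snplus (n : ℕ) : Set (Fin (n+1) → ℂ) :=
  {z | ∃ x : Fin (n+1) → ℝ, 0 < x 0 ∧ (∑ i, (x i)^2) = 1 ∧
    z 0 = Complex.I * (x 0 : ℂ) ∧ ∀ i, i ≠ 0 → z i = (x i : ℂ)}

/-- The crown domain `Ξ = G · S^n_+ ⊂ ℂ^{1+n}`. -/
def Xi (n : ℕ) : Set (Fin (n+1) → ℂ) :=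
  {z | ∃ g w, memG n g ∧ w ∈ Snplus n ∧ z = (g.map (Complex.ofReal)).mulVec w}

/-- The conjugate crown `Ξ̄`. -/
def XiBar (n : ℕ) : Set (Fin (n+1) → ℂ) :=
  {z | (fun i => (starRingEnd ℂ) (z i)) ∈ Xi n}

/-- The de Sitter space `dS^n` viewed inside `ℂ^{1+n}`. -/
def dSC (n : ℕ) : Set (Fin (n+1) → ℂ) :=
  {z | (∀ i, (z i).im = 0) ∧ lformC n z z = 1}

/-- The cut `[1,∞) ⊂ ℂ`. -/
def slit : Set ℂ := {z | z.im = 0 ∧ 1 ≤ z.re}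

/-- Componentwise complex conjugation on `ℂ^{1+n}`. -/
def conjVec (n : ℕ) (z : Fin (n+1) → ℂ) : Fin (n+1) → ℂ :=
  fun i => (starRingEnd ℂ) (z i)

/-- `λ` is admissible: purely imaginary with nonnegative imaginary part, or
real with `0 < λ < ρ = (n−1)/2`. -/
def admissible (n : ℕ) (lam : ℂ) : Prop :=
  (lam.re = 0 ∧ 0 ≤ lam.im) ∨ (lam.im = 0 ∧ 0 < lam.re ∧ lam.re < ((n : ℝ) - 1)/2)

/-- Euler's integral representation of `₂F₁(ρ+λ, ρ−λ; n/2; ·)` on `ℂ∖[1,∞)`,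
with `ρ = (n−1)/2`. -/
def Flam (n : ℕ) (lam : ℂ) (z : ℂ) : ℂ :=
  (Complex.Gamma ((n : ℂ)/2) /
    (Complex.Gamma (((n : ℂ) - 1)/2 - lam) * Complex.Gamma (1/2 + lam))) *
  ∫ t in (0:ℝ)..1, (t : ℂ) ^ (((n : ℂ) - 1)/2 - lam - 1) *
    ((1 : ℂ) - (t : ℂ)) ^ (lam - 1/2) *
    ((1 : ℂ) - z * (t : ℂ)) ^ (-(((n : ℂ) - 1)/2) - lam)

/-- General term of the Gauss hypergeometric series `₂F₁(a,b;c;w)`. -/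
def hypTerm (a b c : ℂ) (w : ℂ) (k : ℕ) : ℂ :=
  (ascPochhammer ℂ k).eval a * (ascPochhammer ℂ k).eval b /
    ((ascPochhammer ℂ k).eval c * (k.factorial : ℂ)) * w ^ k

/-- The curve `z_t = (i cos t, 0, …, 0, sin t)` in the crown `Ξ`. -/
def zCurve (n : ℕ) (t : ℝ) : Fin (n+1) → ℂ :=
  fun i => if i = 0 then Complex.I * (Real.cos t : ℂ)
    else if i = Fin.last n then (Real.sin t : ℂ) else 0

/-- The curve `z̃_t = (−i cos t, 0, …, 0, sin t)` in the conjugate crown `Ξ̄`. -/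
def zCurveBar (n : ℕ) (t : ℝ) : Fin (n+1) → ℂ :=
  fun i => if i = 0 then -Complex.I * (Real.cos t : ℂ)
    else if i = Fin.last n then (Real.sin t : ℂ) else 0

/-- The open future cone `Γ⁺(eₙ)` in `dS^n`. -/
def futureCone (n : ℕ) : Set (Fin (n+1) → ℝ) :=
  {y | lformR n y y = 1 ∧ lformR n (y - elast n) (y - elast n) < 0 ∧ 0 < y 0}

/-- The open past cone `Γ⁻(eₙ)` in `dS^n`. -/
def pastCone (n : ℕ) : Set (Fin (n+1) → ℝ) :=
  {y | lformR n y y = 1 ∧ lformR n (y - elast n) (y - elast n) < 0 ∧ y 0 < 0}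


/-- The boundary value expression in Statement 12 (sign `s = ∓1` for `x ± i0`). -/
def bval (n : ℕ) (lam : ℂ) (x : ℝ) (s : ℝ) : ℂ :=
  (Complex.Gamma ((n : ℂ)/2) * Complex.Gamma ((2 - (n : ℂ))/2) /
      (Complex.Gamma (1/2 + lam) * Complex.Gamma (1/2 - lam))) *
    ∑' k : ℕ, hypTerm (((n : ℂ) - 1)/2 + lam) (((n : ℂ) - 1)/2 - lam) ((n : ℂ)/2)
      ((1 : ℂ) - x) k
  + Complex.exp ((s : ℂ) * (Real.pi : ℂ) * Complex.I * ((2 - (n : ℂ))/2)) *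
      (((x - 1) ^ ((2 - (n : ℝ))/2) : ℝ) : ℂ) *
      (Complex.Gamma ((n : ℂ)/2) * Complex.Gamma (((n : ℂ) - 2)/2) /
        (Complex.Gamma (((n : ℂ) - 1)/2 + lam) * Complex.Gamma (((n : ℂ) - 1)/2 - lam))) *
    ∑' k : ℕ, hypTerm (1/2 - lam) (1/2 + lam) ((4 - (n : ℂ))/2) ((1 : ℂ) - x) k

end

open MeasureTheory Metric in
/-- A parametric integral of holomorphic functions with a locally uniform integrable bound is
holomorphic. -/
theorem differentiableOn_integral_of_dominated {α : Type*} [MeasurableSpace α] {μ : Measure α}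
    {U : Set ℂ} (hU : IsOpen U) {f : ℂ → α → ℂ}
    (hm : ∀ w ∈ U, AEStronglyMeasurable (f w) μ)
    (hd : ∀ᵐ a ∂μ, DifferentiableOn ℂ (fun w => f w a) U)
    (hb : ∀ w₀ ∈ U, ∃ bound : α → ℝ, Integrable bound μ ∧
      ∃ r > 0, ∀ᵐ a ∂μ, ∀ w ∈ ball w₀ r, ‖f w a‖ ≤ bound a) :
    DifferentiableOn ℂ (fun w => ∫ a, f w a ∂μ) U := by
  intro w₀ hw₀
  obtain ⟨bound, hbi, r₁, hr₁, hbd⟩ := hb w₀ hw₀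
  obtain ⟨r₂, hr₂, hr₂U⟩ := Metric.isOpen_iff.1 hU w₀ hw₀
  obtain ⟨r, hr, hrr₁, hrr₂⟩ : ∃ r > 0, r ≤ r₁ ∧ r ≤ r₂ :=
    ⟨min r₁ r₂, lt_min hr₁ hr₂, min_le_left _ _, min_le_right _ _⟩
  have hrU : ball w₀ r ⊆ U := (ball_subset_ball hrr₂).trans hr₂U
  have hder : ∀ᵐ a ∂μ, ∀ w ∈ ball w₀ (r / 2),
      HasDerivAt (fun w => f w a) (deriv (fun w => f w a) w) w := by
    filter_upwards [hd] with a ha w hw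
    exact (ha.differentiableAt (hU.mem_nhds
      (hrU (ball_subset_ball (by linarith) hw)))).hasDerivAt
  have hmeas : AEStronglyMeasurable (fun a => deriv (fun w => f w a) w₀) μ := by
    have hlim : Tendsto (fun n : ℕ => w₀ + ((r / 2 / (n + 1) : ℝ) : ℂ)) atTop (𝓝[≠] w₀) := by
      refine tendsto_nhdsWithin_iff.2 ⟨?_, Eventually.of_forall fun n => ?_⟩
      · have h : Tendsto (fun n : ℕ => (r / 2) / ((n : ℝ) + 1)) atTop (𝓝 0) := by
          have := (tendsto_one_div_add_atTop_nhds_zero_nat (𝕜 := ℝ)).const_mul (r / 2)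
          simpa [div_eq_mul_inv] using this
        have h2 := ((Complex.continuous_ofReal.tendsto 0).comp h).const_add w₀
        simpa using h2
      · have : (r / 2 / ((n : ℝ) + 1)) ≠ 0 := by positivity
        simp only [Set.mem_compl_iff, Set.mem_singleton_iff, add_eq_left]
        exact_mod_cast this
    refine aestronglyMeasurable_of_tendsto_ae atTop
      (f := fun (n : ℕ) a => slope (fun w => f w a) w₀ (w₀ + ((r / 2 / (n + 1) : ℝ) : ℂ)))
      (fun n => ?_) ?_
    · simp only [slope, vsub_eq_sub]
      refine ((hm (w₀ + ((r / 2 / (n + 1) : ℝ) : ℂ)) (hrU ?_)).sub (hm w₀ hw₀)).const_smul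
        ((w₀ + ((r / 2 / (n + 1) : ℝ) : ℂ) - w₀)⁻¹)
      rw [mem_ball, dist_self_add_left, Complex.norm_real, Real.norm_of_nonneg (by positivity)]
      have : r / 2 / ((n : ℝ) + 1) ≤ r / 2 := div_le_self (by positivity) (by simp)
      linarith
    · filter_upwards [hder] with a ha
      exact (hasDerivAt_iff_tendsto_slope.1 (ha w₀ (mem_ball_self (by positivity)))).comp hlim
  refine (hasDerivAt_integral_of_dominated_loc_of_deriv_le
    (F := f) (F' := fun w a => deriv (fun w => f w a) w) (bound := fun a => bound a / (r / 4))
    (ball_mem_nhds w₀ (half_pos hr)) ?_ ?_ hmeas ?_ (hbi.div_const _)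
    hder).2.differentiableAt.differentiableWithinAt
  · filter_upwards [hU.mem_nhds hw₀] with w hw using hm w hw
  · refine hbi.mono' (hm _ hw₀) ?_
    filter_upwards [hbd] with a ha using ha _ (mem_ball_self hr₁)
  · filter_upwards [hbd, hd] with a ha hda w hw
    have hsub : closedBall w (r / 4) ⊆ ball w₀ r := by
      intro x hx
      rw [mem_ball] at hw ⊢
      rw [mem_closedBall] at hx
      linarith [dist_triangle x w w₀]
    refine Complex.norm_deriv_le_of_forall_mem_sphere_norm_le (by positivity) ?_ ?_
    · refine DifferentiableOn.diffContOnCl ?_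
      rw [closure_ball _ (by positivity)]
      exact hda.mono (hsub.trans hrU)
    · intro z hz
      exact ha z (ball_subset_ball hrr₁ (hsub (sphere_subset_closedBall hz)))

/-- The cut plane `ℂ ∖ [1,∞)`. -/
def cutPlane : Set ℂ := {z | 1 - z ∈ Complex.slitPlane}

theorem isOpen_cutPlane : IsOpen cutPlane :=
  Complex.isOpen_slitPlane.preimage (by fun_prop)

theorem mul_mem_cutPlane {z : ℂ} (hz : z ∈ cutPlane) {t : ℝ} (h0 : 0 ≤ t) (h1 : t ≤ 1) :
    z * t ∈ cutPlane := by
  have h := Complex.starConvex_one_slitPlane hz (sub_nonneg.2 h1) h0 (by ring)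
  have e : (1 - z * t : ℂ) = (1 - t) • (1 : ℂ) + t • (1 - z) := by
    simp only [Complex.real_smul]; push_cast; ring
  rw [cutPlane, Set.mem_ofPred_eq, e]
  exact h

theorem isPreconnected_cutPlane : IsPreconnected cutPlane := by
  have h : StarConvex ℝ 0 cutPlane := by
    rw [starConvex_zero_iff]
    intro x hx a h0 h1
    simpa [mul_comm] using mul_mem_cutPlane hx h0 h1
  exact h.isPathConnected (by simp [cutPlane]) |>.isConnected.isPreconnected

open MeasureTheory in
/-- Euler-type integrals are holomorphic on the cut plane. -/
theorem differentiableOn_eulerIntegral {u : ℝ → ℂ} (hu : IntervalIntegrable u volume 0 1)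
    {φ : ℝ → ℝ} (hφ : Continuous φ) (hφ01 : ∀ t ∈ Set.Icc (0 : ℝ) 1, φ t ∈ Set.Icc (0 : ℝ) 1)
    (s : ℂ) :
    DifferentiableOn ℂ (fun z : ℂ => ∫ t in (0:ℝ)..1, u t * (1 - z * φ t) ^ s) cutPlane := by
  simp_rw [intervalIntegral.integral_of_le zero_le_one]
  have hcont : ContinuousOn (fun p : ℂ × ℝ => (1 - p.1 * φ p.2) ^ s)
      (cutPlane ×ˢ Set.Icc (0 : ℝ) 1) := by
    refine ContinuousOn.cpow_const (by fun_prop) ?_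
    rintro ⟨z, t⟩ ⟨hz, ht⟩
    exact mul_mem_cutPlane hz (hφ01 t ht).1 (hφ01 t ht).2
  have hu' : IntegrableOn u (Set.Ioc 0 1) :=
    (intervalIntegrable_iff_integrableOn_Ioc_of_le zero_le_one).1 hu
  refine differentiableOn_integral_of_dominated isOpen_cutPlane ?_ ?_ ?_
  · intro z hz
    refine hu'.aestronglyMeasurable.mul (ContinuousOn.aestronglyMeasurable ?_ measurableSet_Ioc)
    exact hcont.comp (f := fun t : ℝ => (z, t)) (by fun_prop)
      fun t ht => ⟨hz, Set.Ioc_subset_Icc_self ht⟩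
  · filter_upwards [ae_restrict_mem measurableSet_Ioc] with t ht
    refine DifferentiableOn.const_mul ?_ _
    refine DifferentiableOn.cpow_const (by fun_prop) ?_
    intro z hz
    have := hφ01 t (Set.Ioc_subset_Icc_self ht)
    exact mul_mem_cutPlane hz this.1 this.2
  · intro z₀ hz₀
    obtain ⟨r, hr, hrU⟩ := Metric.nhds_basis_closedBall.mem_iff.1 (isOpen_cutPlane.mem_nhds hz₀)
    obtain ⟨C, hC⟩ := ((isCompact_closedBall z₀ r).prod (isCompact_Icc (a := (0 : ℝ))
      (b := 1))).exists_bound_of_continuousOn (hcont.mono (Set.prod_mono hrU subset_rfl))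
    refine ⟨fun t => ‖u t‖ * C, hu'.norm.mul_const C, r, hr, ?_⟩
    filter_upwards [ae_restrict_mem measurableSet_Ioc] with t ht z hz
    rw [norm_mul]
    exact mul_le_mul_of_nonneg_left
      (hC (z, t) ⟨Metric.ball_subset_closedBall hz, Set.Ioc_subset_Icc_self ht⟩) (norm_nonneg _)

open MeasureTheory in
/-- Power series expansion of Euler-type integrals. -/
theorem hasSum_eulerIntegral {u : ℝ → ℂ} (hu : IntervalIntegrable u volume 0 1)
    {φ : ℝ → ℝ} (hφ : Continuous φ) (hφ01 : ∀ t ∈ Set.Icc (0 : ℝ) 1, φ t ∈ Set.Icc (0 : ℝ) 1)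
    (s : ℂ) {z : ℂ} (hz : ‖z‖ < 1) :
    HasSum (fun k : ℕ => Ring.choose s k * (-z) ^ k * ∫ t in (0:ℝ)..1, u t * (φ t : ℂ) ^ k)
      (∫ t in (0:ℝ)..1, u t * (1 - z * φ t) ^ s) := by
  have hps := Complex.one_add_cpow_hasFPowerSeriesOnBall_zero (a := s)
  have hsum : ∀ x : ℂ, ‖x‖ < 1 → HasSum (fun k : ℕ => Ring.choose s k * x ^ k) ((1 + x) ^ s) := by
    intro x hx
    have := hps.hasSum (y := x) (by simpa [enorm_eq_nnnorm, ← NNReal.coe_lt_coe] using hx)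
    rw [zero_add] at this
    convert! this using 2 with k
    rw [binomialSeries_apply]; simp
  have habs : Summable fun k : ℕ => ‖Ring.choose s k‖ * ‖z‖ ^ k := by
    have := (hsum ‖z‖ (by simpa using hz)).summable.norm
    simpa using this
  simp_rw [← intervalIntegral.integral_const_mul]
  refine intervalIntegral.hasSum_integral_of_dominated_convergence
    (bound := fun k t => ‖u t‖ * (‖Ring.choose s k‖ * ‖z‖ ^ k)) ?_ ?_ ?_ ?_ ?_
  · intro k
    have := hu.aestronglyMeasurable
    rw [Set.uIoc_of_le zero_le_one]
    refine (AEStronglyMeasurable.mul ?_ ?_).const_mul _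
    · exact this
    · exact Continuous.aestronglyMeasurable (by fun_prop)
  · intro k
    refine Eventually.of_forall fun t ht => ?_
    rw [Set.uIoc_of_le zero_le_one] at ht
    have h := hφ01 t (Set.Ioc_subset_Icc_self ht)
    simp only [norm_mul, norm_pow, norm_neg, Complex.norm_real, Real.norm_of_nonneg h.1]
    have h1 : φ t ^ k ≤ 1 := pow_le_one₀ h.1 h.2
    calc ‖Ring.choose s k‖ * ‖z‖ ^ k * (‖u t‖ * φ t ^ k)
        ≤ ‖Ring.choose s k‖ * ‖z‖ ^ k * (‖u t‖ * 1) := by gcongr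
      _ = _ := by ring
  · exact Eventually.of_forall fun t _ => habs.mul_left _
  · simp_rw [tsum_mul_left]
    exact hu.norm.mul_const _
  · refine Eventually.of_forall fun t ht => ?_
    rw [Set.uIoc_of_le zero_le_one] at ht
    have h := hφ01 t (Set.Ioc_subset_Icc_self ht)
    have hlt : ‖-(z * φ t)‖ < 1 := by
      rw [norm_neg, norm_mul, Complex.norm_real, Real.norm_of_nonneg h.1]
      exact (mul_le_of_le_one_right (norm_nonneg _) h.2).trans_lt hz
    have := (hsum _ hlt).mul_left (u t)
    rw [← sub_eq_add_neg] at this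
    convert! this using 2 with k
    rw [← neg_mul, mul_pow]; ring

theorem choose_succ_eq_mul_div (s : ℂ) (k : ℕ) :
    Ring.choose s (k + 1) = Ring.choose s k * (s - k) / (k + 1) := by
  rw [Ring.choose_eq_smul, Ring.choose_eq_smul, descPochhammer_succ_right, Polynomial.smeval_mul,
    Polynomial.smeval_sub, Polynomial.smeval_X, Polynomial.smeval_natCast, Nat.factorial_succ]
  have : (k.factorial : ℂ) ≠ 0 := by exact_mod_cast k.factorial_ne_zero
  have : (k : ℂ) + 1 ≠ 0 := by exact_mod_cast k.succ_ne_zero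
  simp only [smul_eq_mul, pow_one, pow_zero, nsmul_eq_mul, mul_one]
  push_cast
  field_simp

open Complex in
theorem euler_coeff_eq {ρ : ℝ} (hρ : 0 < ρ) {l : ℂ} (hl0 : 0 ≤ l.re) (hl1 : l.re < ρ) (k : ℕ) :
    Gamma (ρ + 1 / 2) / (Gamma (ρ - l) * Gamma (1 / 2 + l)) *
      (Ring.choose (-ρ - l : ℂ) k * (Gamma (ρ - l + k) * Gamma (1 / 2 + l) /
        Gamma (ρ + 1 / 2 + k))) =
    Gamma (2 * ρ) / (Gamma (ρ + l) * Gamma (ρ - l)) *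
      (Ring.choose (-ρ : ℂ) k * (4 ^ k * (Gamma (ρ + l + k) * Gamma (ρ - l + k) /
        Gamma (2 * ρ + 2 * k)))) := by
  have hne : ∀ {s : ℂ}, 0 < s.re → s ≠ 0 := by rintro s hs rfl; simp at hs
  induction k with
  | zero =>
    have h1 : Gamma (ρ - l) ≠ 0 := Gamma_ne_zero_of_re_pos (by simpa using hl1)
    have h2 : Gamma (ρ + l) ≠ 0 := Gamma_ne_zero_of_re_pos (by simp; linarith)
    have h3 : Gamma (1 / 2 + l) ≠ 0 := Gamma_ne_zero_of_re_pos (by simp; linarith)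
    have h4 : Gamma (ρ + 1 / 2 : ℂ) ≠ 0 := Gamma_ne_zero_of_re_pos (by simp; linarith)
    have h5 : Gamma (2 * ρ : ℂ) ≠ 0 := Gamma_ne_zero_of_re_pos (by simp; linarith)
    simp only [CharP.cast_eq_zero, add_zero, Ring.choose_zero_right, mul_zero, pow_zero, one_mul]
    generalize Gamma (ρ - l) = A at *
    generalize Gamma (ρ + l) = B at *
    generalize Gamma (1 / 2 + l) = C at *
    generalize Gamma (ρ + 1 / 2 : ℂ) = D at *
    generalize Gamma (2 * ρ : ℂ) = E at *
    field_simp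
  | succ k ih =>
    have hk : (0 : ℝ) ≤ k := k.cast_nonneg
    have h1 : (ρ - l + k : ℂ) ≠ 0 := hne (by simp; linarith)
    have h2 : (ρ + l + k : ℂ) ≠ 0 := hne (by simp; linarith)
    have h3 : (ρ + 1 / 2 + k : ℂ) ≠ 0 := hne (by simp; linarith)
    have h4 : (2 * ρ + 2 * k : ℂ) ≠ 0 := hne (by simp; linarith)
    have h5 : (2 * ρ + 2 * k + 1 : ℂ) ≠ 0 := hne (by simp; linarith)
    have h6 : (k : ℂ) + 1 ≠ 0 := by exact_mod_cast k.succ_ne_zero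
    have e1 := Gamma_add_one _ h1
    have e2 := Gamma_add_one _ h2
    have e3 := Gamma_add_one _ h3
    have e4 := Gamma_add_one _ h4
    have e5 := Gamma_add_one _ h5
    have c1 : (ρ - l + (k + 1 : ℕ) : ℂ) = ρ - l + k + 1 := by push_cast; ring
    have c2 : (ρ + l + (k + 1 : ℕ) : ℂ) = ρ + l + k + 1 := by push_cast; ring
    have c3 : (ρ + 1 / 2 + (k + 1 : ℕ) : ℂ) = ρ + 1 / 2 + k + 1 := by push_cast; ring
    have c4 : (2 * ρ + 2 * (k + 1 : ℕ) : ℂ) = 2 * ρ + 2 * k + 1 + 1 := by push_cast; ring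
    rw [choose_succ_eq_mul_div, choose_succ_eq_mul_div, c1, c2, c3, c4, e1, e2, e3, e5, e4]
    have hG : Gamma (2 * ρ + 2 * k) ≠ 0 := Gamma_ne_zero_of_re_pos (by simp; linarith)
    have hG' : Gamma (ρ + 1 / 2 + k) ≠ 0 := Gamma_ne_zero_of_re_pos (by simp; linarith)
    trans (-(ρ + l + k) * (ρ - l + k) / ((k + 1) * (ρ + 1 / 2 + k))) *
      (Gamma (ρ + 1 / 2) / (Gamma (ρ - l) * Gamma (1 / 2 + l)) *
      (Ring.choose (-ρ - l : ℂ) k * (Gamma (ρ - l + k) * Gamma (1 / 2 + l) /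
        Gamma (ρ + 1 / 2 + k))))
    · field_simp
      ring
    · rw [ih]
      have h3' : (2 * ρ + 2 * k + 1 : ℂ) = 2 * (ρ + 1 / 2 + k) := by ring
      have h4' : (2 * ρ + 2 * k : ℂ) = 2 * (ρ + k) := by ring
      have h7 : (ρ + k : ℂ) ≠ 0 := hne (by simp; linarith)
      rw [h3']
      simp only [h4'] at hG ⊢
      field_simp
      ring

open MeasureTheory Complex in
/-- A quadratic transformation of the hypergeometric function, for its Euler integrals. -/
theorem euler_quadratic_transformation {ρ : ℝ} (hρ : 0 < ρ) {l : ℂ} (hl0 : 0 ≤ l.re)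
    (hl1 : l.re < ρ) {z : ℂ} (hz : z ∈ cutPlane) :
    Gamma (ρ + 1 / 2) / (Gamma (ρ - l) * Gamma (1 / 2 + l)) *
      ∫ t in (0:ℝ)..1, (t : ℂ) ^ (ρ - l - 1) * (1 - (t : ℂ)) ^ (l - 1 / 2) *
        (1 - z * (t : ℂ)) ^ (-ρ - l) =
    Gamma (2 * ρ) / (Gamma (ρ + l) * Gamma (ρ - l)) *
      ∫ t in (0:ℝ)..1, (t : ℂ) ^ (ρ + l - 1) * (1 - (t : ℂ)) ^ (ρ - l - 1) *
        (1 - z * ((4 * t * (1 - t) : ℝ) : ℂ)) ^ (-ρ : ℂ) := by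
  have r1 : 0 < (ρ - l : ℂ).re := by simpa using hl1
  have r2 : 0 < (ρ + l : ℂ).re := by simp; linarith
  have r3 : 0 < (1 / 2 + l : ℂ).re := by simp; linarith
  have hu1 : IntervalIntegrable (fun t : ℝ => (t : ℂ) ^ (ρ - l - 1) *
      (1 - (t : ℂ)) ^ (l - 1 / 2)) volume 0 1 := by
    have := betaIntegral_convergent r1 r3
    rwa [show (1 / 2 + l - 1 : ℂ) = l - 1 / 2 by ring] at this
  have hu2 : IntervalIntegrable (fun t : ℝ => (t : ℂ) ^ (ρ + l - 1) *
      (1 - (t : ℂ)) ^ (ρ - l - 1)) volume 0 1 := betaIntegral_convergent r2 r1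
  have hφ : ∀ t ∈ Set.Icc (0 : ℝ) 1, 4 * t * (1 - t) ∈ Set.Icc (0 : ℝ) 1 := by
    rintro t ⟨h0, h1⟩
    exact ⟨by nlinarith, by nlinarith [sq_nonneg (2 * t - 1)]⟩
  have hF := (differentiableOn_eulerIntegral hu1 continuous_id (fun t ht => ht)
    (-ρ - l)).const_mul (Gamma (ρ + 1 / 2) / (Gamma (ρ - l) * Gamma (1 / 2 + l)))
  have hG := (differentiableOn_eulerIntegral hu2 (φ := fun t => 4 * t * (1 - t)) (by fun_prop) hφ
    (-ρ)).const_mul (Gamma (2 * ρ) / (Gamma (ρ + l) * Gamma (ρ - l)))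
  have hpow : ∀ {t : ℝ}, 0 < t → ∀ (a : ℂ) (k : ℕ), (t : ℂ) ^ (a + k - 1) = t ^ (a - 1) * t ^ k := by
    intro t ht a k
    rw [← cpow_natCast, ← cpow_add _ _ (by exact_mod_cast ht.ne')]
    congr 1; ring
  have hIoo : ∀ f g : ℝ → ℂ, (∀ t ∈ Set.Ioo (0 : ℝ) 1, f t = g t) →
      ∫ t in (0:ℝ)..1, f t = ∫ t in (0:ℝ)..1, g t := by
    intro f g h
    rw [intervalIntegral.integral_of_le zero_le_one, intervalIntegral.integral_of_le zero_le_one,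
      integral_Ioc_eq_integral_Ioo, integral_Ioc_eq_integral_Ioo]
    exact setIntegral_congr_fun measurableSet_Ioo h
  have m1 : ∀ k : ℕ, ∫ t in (0:ℝ)..1, ((t : ℂ) ^ (ρ - l - 1) * (1 - (t : ℂ)) ^ (l - 1 / 2)) *
      ((id t : ℝ) : ℂ) ^ k = Gamma (ρ - l + k) * Gamma (1 / 2 + l) / Gamma (ρ + 1 / 2 + k) := by
    intro k
    have := betaIntegral_eq_Gamma_mul_div (ρ - l + k) (1 / 2 + l)
      (by have := k.cast_nonneg (α := ℝ); simp; linarith) r3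
    rw [show (ρ - l + k + (1 / 2 + l) : ℂ) = ρ + 1 / 2 + k by ring] at this
    rw [← this, betaIntegral]
    refine hIoo _ _ fun t ht => ?_
    rw [hpow ht.1, show (1 / 2 + l - 1 : ℂ) = l - 1 / 2 by ring]
    simp only [id]; ring
  have m2 : ∀ k : ℕ, ∫ t in (0:ℝ)..1, ((t : ℂ) ^ (ρ + l - 1) * (1 - (t : ℂ)) ^ (ρ - l - 1)) *
      ((4 * t * (1 - t) : ℝ) : ℂ) ^ k =
      4 ^ k * (Gamma (ρ + l + k) * Gamma (ρ - l + k) / Gamma (2 * ρ + 2 * k)) := by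
    intro k
    have hk := k.cast_nonneg (α := ℝ)
    have := betaIntegral_eq_Gamma_mul_div (ρ + l + k) (ρ - l + k)
      (by simp; linarith) (by simp; linarith)
    rw [show (ρ + l + k + (ρ - l + k) : ℂ) = 2 * ρ + 2 * k by ring] at this
    rw [← this, betaIntegral, ← intervalIntegral.integral_const_mul]
    refine hIoo _ _ fun t ht => ?_
    have h2 := hpow (sub_pos.2 ht.2) (ρ - l) k
    push_cast at h2 ⊢
    rw [hpow ht.1, h2, mul_pow, mul_pow]
    ring
  refine (hF.analyticOnNhd isOpen_cutPlane).eqOn_of_preconnected_of_eventuallyEq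
    (hG.analyticOnNhd isOpen_cutPlane) isPreconnected_cutPlane
    (z₀ := 0) (by simp [cutPlane]) ?_ hz
  filter_upwards [Metric.ball_mem_nhds (0 : ℂ) one_pos] with w hw
  rw [mem_ball_zero_iff] at hw
  have s1 := (hasSum_eulerIntegral hu1 continuous_id (fun t ht => ht) (-ρ - l) hw).mul_left
    (Gamma (ρ + 1 / 2) / (Gamma (ρ - l) * Gamma (1 / 2 + l)))
  have s2 := (hasSum_eulerIntegral hu2 (φ := fun t => 4 * t * (1 - t)) (by fun_prop) hφ
    (-ρ) hw).mul_left (Gamma (2 * ρ) / (Gamma (ρ + l) * Gamma (ρ - l)))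
  simp_rw [m1] at s1
  simp_rw [m2] at s2
  refine s1.unique ?_
  convert! s2 using 2 with k
  linear_combination (-w) ^ k * euler_coeff_eq hρ hl0 hl1 k

open MeasureTheory in
theorem integrable_exp_mul_sub_mul_abs {a b : ℝ} (h : |a| < b) :
    Integrable (fun x : ℝ => Real.exp (a * x - b * |x|)) := by
  have h1 := abs_lt.1 h
  rw [← integrableOn_univ, ← Set.Iic_union_Ioi (a := (0 : ℝ)), integrableOn_union]
  constructor
  · refine (integrableOn_exp_mul_Iic (a := a + b) (by linarith) 0).congr_fun ?_ measurableSet_Iic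
    intro x hx
    simp only [abs_of_nonpos hx.out]
    ring_nf
  · refine (integrableOn_exp_mul_Ioi (a := a - b) (by linarith) 0).congr_fun ?_ measurableSet_Ioi
    intro x hx
    simp only [abs_of_pos hx.out]
    ring_nf

open MeasureTheory in
theorem integrable_norm_rpow_mul_exp_neg {d : ℕ} (hd : 0 < d) {s b : ℝ} (hs : s < d) (hb : 0 < b) :
    Integrable (fun k : EuclideanSpace ℝ (Fin d) => ‖k‖ ^ (-s) * Real.exp (-b * ‖k‖)) := by
  have : Nonempty (Fin d) := ⟨⟨0, hd⟩⟩
  rw [integrable_fun_norm_addHaar volume (f := fun y : ℝ => y ^ (-s) * Real.exp (-b * y))]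
  have := integrableOn_rpow_mul_exp_neg_mul_rpow (p := 1) (s := d - 1 - s) (b := b)
    (by linarith) one_pos hb
  refine this.congr_fun ?_ measurableSet_Ioi
  intro y hy
  have hy : 0 < y := hy
  simp only [Real.rpow_one, finrank_euclideanSpace, Fintype.card_fin, smul_eq_mul]
  rw [← mul_assoc, ← Real.rpow_natCast, ← Real.rpow_add hy, Nat.cast_sub hd]
  simp [sub_eq_add_neg]

theorem Real.exp_neg_le_mul_rpow_neg {s y : ℝ} (hs : 0 < s) (hy : 0 < y) :
    Real.exp (-y) ≤ s ^ s * y ^ (-s) := by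
  have h1 : y / s ≤ Real.exp (y / s) := by linarith [Real.add_one_le_exp (y / s)]
  have h2 := Real.rpow_le_rpow (by positivity) h1 hs.le
  rw [← Real.exp_mul, div_mul_cancel₀ _ hs.ne', Real.div_rpow hy.le hs.le,
    div_le_iff₀ (by positivity)] at h2
  rw [Real.exp_neg, Real.rpow_neg hy.le, inv_le_iff_one_le_mul₀ (by positivity)]
  have h3 : 0 < y ^ s := by positivity
  calc (1 : ℝ) = (y ^ s)⁻¹ * y ^ s := by field_simp
    _ ≤ (y ^ s)⁻¹ * (Real.exp y * s ^ s) := by gcongr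
    _ = _ := by ring

open MeasureTheory in
theorem integrable_exp_mul_exp_neg_norm_mul_cosh {d : ℕ} (hd : 0 < d) {μ r₁ r₂ : ℝ}
    (hμ : |μ| < d / 2) (h₁ : 0 < r₁) (h₂ : 0 < r₂) :
    Integrable (fun p : EuclideanSpace ℝ (Fin d) × ℝ × ℝ => Real.exp (μ * (p.2.1 + p.2.2)) *
      Real.exp (-(‖p.1‖ * (r₁ * Real.cosh p.2.1 + r₂ * Real.cosh p.2.2)))) := by
  obtain ⟨s, hs1, hs2⟩ := exists_between hμ
  have hs0 : 0 < s := (abs_nonneg μ).trans_lt hs1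
  obtain ⟨r, hr, hr1, hr2⟩ : ∃ r > 0, r ≤ r₁ ∧ r ≤ r₂ :=
    ⟨min r₁ r₂, lt_min h₁ h₂, min_le_left _ _, min_le_right _ _⟩
  have hI := ((integrable_norm_rpow_mul_exp_neg hd (s := 2 * s) (b := r) (by linarith) hr).mul_prod
    ((integrable_exp_mul_sub_mul_abs hs1).mul_prod
      (integrable_exp_mul_sub_mul_abs hs1))).const_mul
        ((2 * s) ^ (2 * s) * (r / 2) ^ (-(2 * s)))
  refine hI.mono' (by fun_prop) ?_
  have : Nonempty (Fin d) := ⟨⟨0, hd⟩⟩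
  have hae : ∀ᵐ p : EuclideanSpace ℝ (Fin d) × ℝ × ℝ, p.1 ≠ 0 := by
    have : ∀ᵐ k : EuclideanSpace ℝ (Fin d), k ≠ 0 := by
      simp [ae_iff]
    exact Measure.quasiMeasurePreserving_fst.ae this
  filter_upwards [hae] with ⟨k, a, b⟩ hk
  have hk : 0 < ‖k‖ := norm_pos_iff.2 hk
  simp only [norm_mul, Real.norm_eq_abs, Real.abs_exp]
  have hc : ∀ x : ℝ, Real.exp |x| ≤ 2 * Real.cosh x := fun x => by
    rw [← Real.cosh_abs, Real.cosh_eq]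
    linarith [Real.exp_pos (-|x|)]
  have hE : 2 * Real.exp ((|a| + |b|) / 2) ≤ Real.exp |a| + Real.exp |b| := by
    have e1 : Real.exp |a| = Real.exp (|a| / 2) ^ 2 := by rw [← Real.exp_nat_mul]; ring_nf
    have e2 : Real.exp |b| = Real.exp (|b| / 2) ^ 2 := by rw [← Real.exp_nat_mul]; ring_nf
    rw [e1, e2, add_div, Real.exp_add]
    nlinarith [sq_nonneg (Real.exp (|a| / 2) - Real.exp (|b| / 2))]
  have hT : r * (1 + Real.exp ((|a| + |b|) / 2) / 2) ≤ r₁ * Real.cosh a + r₂ * Real.cosh b := by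
    have ha := Real.one_le_cosh a
    have hb := Real.one_le_cosh b
    calc _ ≤ r * (Real.cosh a + Real.cosh b) := by
          exact mul_le_mul_of_nonneg_left (by linarith [hc a, hc b]) hr.le
      _ ≤ _ := by rw [mul_add]; gcongr
  have hy0 : 0 < ‖k‖ * (r / 2) * Real.exp ((|a| + |b|) / 2) := by positivity
  have key := Real.exp_neg_le_mul_rpow_neg (s := 2 * s) (by positivity) hy0
  calc Real.exp (μ * (a + b)) * Real.exp (-(‖k‖ * (r₁ * Real.cosh a + r₂ * Real.cosh b)))
      ≤ Real.exp (μ * (a + b)) * Real.exp (-(‖k‖ * (r * (1 + Real.exp ((|a| + |b|) / 2) / 2)))) := by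
        gcongr
    _ = Real.exp (μ * (a + b)) * (Real.exp (-r * ‖k‖) *
          Real.exp (-(‖k‖ * (r / 2) * Real.exp ((|a| + |b|) / 2)))) := by
        rw [← Real.exp_add (-r * ‖k‖)]; ring_nf
    _ ≤ Real.exp (μ * (a + b)) * (Real.exp (-r * ‖k‖) * ((2 * s) ^ (2 * s) *
          (‖k‖ * (r / 2) * Real.exp ((|a| + |b|) / 2)) ^ (-(2 * s)))) := by gcongr
    _ = _ := by
        rw [Real.mul_rpow (by positivity) (Real.exp_pos _).le,
          Real.mul_rpow (norm_nonneg k) (by positivity),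
          ← Real.exp_mul, show μ * (a + b) = μ * a + μ * b by ring, Real.exp_add,
          show (|a| + |b|) / 2 * (-(2 * s)) = - s * |a| + -s * |b| by ring, Real.exp_add,
          show μ * a - s * |a| = μ * a + -s * |a| by ring,
          show μ * b - s * |b| = μ * b + -s * |b| by ring, Real.exp_add, Real.exp_add]
        ring

open MeasureTheory in
theorem integral_exp_mul_exp_neg_mul_exp {ρ c : ℝ} (hρ : 0 < ρ) (hc : 0 < c) :
    Integrable (fun q : ℝ => Real.exp (ρ * q) * Real.exp (-(c * Real.exp q))) ∧
    ∫ q : ℝ, Real.exp (ρ * q) * Real.exp (-(c * Real.exp q)) = Real.Gamma ρ * c ^ (-ρ) := by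
  have him : Set.image Real.exp Set.univ = Set.Ioi 0 := by rw [Set.image_univ, Real.range_exp]
  have hder : ∀ x ∈ (Set.univ : Set ℝ), HasDerivWithinAt Real.exp (Real.exp x) Set.univ x :=
    fun x _ => (Real.hasDerivAt_exp x).hasDerivWithinAt
  have hinj : Set.InjOn Real.exp Set.univ := Real.exp_injective.injOn
  have hpt : ∀ q : ℝ, |Real.exp q| • ((Real.exp q) ^ (ρ - 1) * Real.exp (-(c * Real.exp q))) =
      Real.exp (ρ * q) * Real.exp (-(c * Real.exp q)) := fun q => by
    rw [Real.abs_exp, smul_eq_mul, ← mul_assoc, ← Real.exp_mul, ← Real.exp_add]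
    ring_nf
  have hint := integrableOn_image_iff_integrableOn_abs_deriv_smul MeasurableSet.univ hder hinj
    (fun x : ℝ => x ^ (ρ - 1) * Real.exp (-(c * x)))
  have heq := integral_image_eq_integral_abs_deriv_smul MeasurableSet.univ hder hinj
    (fun x : ℝ => x ^ (ρ - 1) * Real.exp (-(c * x)))
  simp only [hpt, him, integrableOn_univ, Measure.restrict_univ] at hint heq
  refine ⟨hint.1 ?_, ?_⟩
  · simpa using integrableOn_rpow_mul_exp_neg_mul_rpow (p := 1) (s := ρ - 1) (b := c)
      (by linarith) one_pos hc
  · rw [← heq, Real.integral_rpow_mul_exp_neg_mul_Ioi hρ hc, one_div, Real.inv_rpow hc.le,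
      Real.rpow_neg hc.le]
    ring

open MeasureTheory in
theorem integral_gaussian_mixture {d : ℕ} (hd : 0 < d) {D : ℝ} (hD : 0 < D)
    (w : EuclideanSpace ℝ (Fin d)) :
    ∫ k : EuclideanSpace ℝ (Fin d), Complex.exp (Complex.I * (inner ℝ w k : ℝ)) *
      ((∫ q : ℝ, Real.exp (-((Real.exp q + D * ‖k‖ ^ 2 * Real.exp (-q)) / 2)) : ℝ) : ℂ) =
    (((4 * Real.pi) ^ (d / 2 : ℝ) * Real.Gamma (d / 2) * (D + ‖w‖ ^ 2) ^ (-(d / 2 : ℝ)) : ℝ) : ℂ) := by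
  have hd' : (0 : ℝ) < d / 2 := by positivity
  set b : ℝ → ℝ := fun q => D * Real.exp (-q) / 2 with hb
  have hb0 : ∀ q, 0 < b q := fun q => by positivity
  set f : EuclideanSpace ℝ (Fin d) → ℝ → ℂ := fun k q =>
    Complex.exp (-(b q : ℂ) * (‖k‖ : ℂ) ^ 2 + Complex.I * (inner ℝ w k : ℝ)) *
      (Real.exp (-(Real.exp q / 2)) : ℝ) with hf
  have hf1 : ∀ k q, Complex.exp (Complex.I * (inner ℝ w k : ℝ)) *
      ((Real.exp (-((Real.exp q + D * ‖k‖ ^ 2 * Real.exp (-q)) / 2)) : ℝ) : ℂ) = f k q := by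
    intro k q
    simp only [hf, hb]
    push_cast
    rw [← Complex.exp_add, ← Complex.exp_add]
    ring_nf
  have hpow : ∀ q, (Real.pi / b q) ^ (d / 2 : ℝ) =
      (2 * Real.pi / D) ^ (d / 2 : ℝ) * Real.exp (d / 2 * q) := fun q => by
    rw [show Real.pi / b q = 2 * Real.pi / D * Real.exp q by
      simp only [hb]; rw [Real.exp_neg]; field_simp, Real.mul_rpow (by positivity)
      (Real.exp_pos _).le, ← Real.exp_mul]
    ring_nf
  have hmeas : AEStronglyMeasurable (Function.uncurry f)
      ((volume : Measure (EuclideanSpace ℝ (Fin d))).prod (volume : Measure ℝ)) := by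
    apply Continuous.aestronglyMeasurable
    simp only [hf, hb, Function.uncurry_def]
    fun_prop
  have hint : Integrable (Function.uncurry f)
      ((volume : Measure (EuclideanSpace ℝ (Fin d))).prod (volume : Measure ℝ)) := by
    rw [integrable_prod_iff' hmeas]
    constructor
    · refine Filter.Eventually.of_forall fun q => ?_
      have hq : 0 < ((b q : ℝ) : ℂ).re := by simpa using hb0 q
      simp only [Function.uncurry_apply_pair, hf]
      exact (GaussianFourier.integrable_cexp_neg_mul_sq_norm_add hq Complex.I w).mul_const _
    · have h1 : ∀ q, ∫ k : EuclideanSpace ℝ (Fin d), ‖Function.uncurry f (k, q)‖ =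
          (2 * Real.pi / D) ^ (d / 2 : ℝ) *
            (Real.exp (d / 2 * q) * Real.exp (-(1 / 2 * Real.exp q))) := by
        intro q
        have h2 : ∀ k, ‖Function.uncurry f (k, q)‖ =
            Real.exp (-b q * ‖k‖ ^ 2) * Real.exp (-(Real.exp q / 2)) := by
          intro k
          simp only [Function.uncurry_apply_pair, hf, norm_mul, Complex.norm_exp,
            Complex.norm_real, Real.norm_eq_abs, Real.abs_exp]
          congr 2
          simp [← Complex.ofReal_pow]
        simp only [h2]
        rw [integral_mul_const, GaussianFourier.integral_rexp_neg_mul_sq_norm (hb0 q)]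
        simp only [finrank_euclideanSpace, Fintype.card_fin, hpow]
        ring_nf
      simp only [h1]
      exact (integral_exp_mul_exp_neg_mul_exp hd' (by norm_num : (0:ℝ) < 1 / 2)).1.const_mul _
  have hin : ∀ q, ∫ k, f k q = (((2 * Real.pi / D) ^ (d / 2 : ℝ) *
      (Real.exp (d / 2 * q) * Real.exp (-((D + ‖w‖ ^ 2) / (2 * D) * Real.exp q))) : ℝ) : ℂ) := by
    intro q
    simp only [hf]
    rw [integral_mul_const, GaussianFourier.integral_cexp_neg_mul_sq_norm_add (b := (b q : ℂ)) (by simpa using hb0 q)]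
    simp only [finrank_euclideanSpace, Fintype.card_fin]
    have := hpow q
    rw [← mul_assoc, ← this]
    have h3 : ((Real.pi / b q : ℝ) : ℂ) ^ ((d / 2 : ℝ) : ℂ) = (((Real.pi / b q) ^ (d / 2 : ℝ) : ℝ) : ℂ) :=
      (Complex.ofReal_cpow (by have := hb0 q; positivity) _).symm
    push_cast at h3 ⊢
    rw [h3, mul_assoc, ← Complex.exp_add]
    congr 2
    simp only [hb]
    push_cast
    rw [Complex.I_sq, Complex.exp_neg]
    have hE := Complex.exp_ne_zero (q : ℂ)
    have hD' : (D : ℂ) ≠ 0 := by exact_mod_cast hD.ne'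
    field_simp
    ring
  have hc : 0 < (D + ‖w‖ ^ 2) / (2 * D) := by positivity
  calc _ = ∫ k, ∫ q, f k q := by
        congr 1
        ext k
        rw [← integral_complex_ofReal, ← integral_const_mul]
        simp only [hf1]
    _ = ∫ q, ∫ k, f k q := integral_integral_swap hint
    _ = _ := by
        simp only [hin]
        rw [integral_complex_ofReal, integral_const_mul, (integral_exp_mul_exp_neg_mul_exp hd' hc).2]
        congr 1
        rw [Real.rpow_neg hc.le, Real.rpow_neg (by positivity), Real.div_rpow (by positivity)
            (by positivity) (x := D + ‖w‖ ^ 2), show 4 * Real.pi = (2 * Real.pi / D) * (2 * D) by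
            field_simp; ring, Real.mul_rpow (x := 2 * Real.pi / D) (by positivity) (by positivity)]
        field_simp

open MeasureTheory in
theorem integral_exp_neg_mul_cosh_add_cosh {r η η' : ℝ} (hr : 0 < r) (h : 0 < η) (h' : 0 < η')
    (u : ℝ) :
    ∫ b : ℝ, Real.exp (-(r * (η * Real.cosh (u - b) + η' * Real.cosh b))) =
      ∫ q : ℝ, Real.exp (-((Real.exp q +
        (η ^ 2 + η' ^ 2 + 2 * η * η' * Real.cosh u) * r ^ 2 * Real.exp (-q)) / 2)) := by
  have hP : 0 < r * (η * Real.exp (-u) + η') := by positivity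
  rw [← integral_add_right_eq_self (fun q : ℝ => Real.exp (-((Real.exp q +
        (η ^ 2 + η' ^ 2 + 2 * η * η' * Real.cosh u) * r ^ 2 * Real.exp (-q)) / 2)))
        (Real.log (r * (η * Real.exp (-u) + η')))]
  congr 1
  ext b
  congr 2
  rw [neg_add, Real.exp_add, Real.exp_add, Real.exp_neg (Real.log _), Real.exp_log hP,
    Real.cosh_eq, Real.cosh_eq, Real.cosh_eq, neg_sub, Real.exp_sub, Real.exp_sub, Real.exp_neg u,
    Real.exp_neg b]
  have hP' := hP.ne'
  rw [Real.exp_neg] at hP'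
  have := Real.exp_pos u
  have := Real.exp_pos b
  have h2 : η + η' * Real.exp u ≠ 0 := by positivity
  field_simp
  ring

open MeasureTheory in
/-- Change of variables `a = u - b` in a pair of real integration variables. -/
theorem integral_shear {α : Type*} [MeasureSpace α] [SFinite (volume : Measure α)]
    {F : α × ℝ × ℝ → ℂ} (hF : Integrable F) :
    ∫ p, F p = ∫ u : ℝ, ∫ k : α, ∫ b : ℝ, F (k, u - b, b) := by
  have hs : MeasurePreserving (fun p : α × ℝ × ℝ => (p.1, p.2.1 - p.2.2, p.2.2)) :=
    (MeasurePreserving.id volume).prod (measurePreserving_sub_prod volume volume)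
  have he := hs.comp (volume_preserving_prodAssoc (α₁ := α) (β₁ := ℝ) (γ₁ := ℝ))
  have hG := he.integrable_comp_of_integrable hF
  calc ∫ p, F p = ∫ q : (α × ℝ) × ℝ, F (q.1.1, q.1.2 - q.2, q.2) := by
        have := integral_map (f := F) he.measurable.aemeasurable
          (by rw [he.map_eq]; exact hF.aestronglyMeasurable)
        rw [he.map_eq] at this
        exact this
    _ = ∫ q : α × ℝ, ∫ b : ℝ, F (q.1, q.2 - b, b) := integral_prod _ hG
    _ = _ := integral_prod_symm _ hG.integral_prod_left

open MeasureTheory in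
theorem integrable_planeWave_real {d : ℕ} (hd : 0 < d) {l : ℂ} (hl : |l.re| < d / 2) {η η' : ℝ}
    (h : 0 < η) (h' : 0 < η') (w : EuclideanSpace ℝ (Fin d)) :
    Integrable fun p : EuclideanSpace ℝ (Fin d) × ℝ × ℝ =>
      Complex.exp (Complex.I * (inner ℝ w p.1 : ℝ)) * Complex.exp (l * (p.2.1 + p.2.2)) *
        (Real.exp (-(‖p.1‖ * (η * Real.cosh p.2.1 + η' * Real.cosh p.2.2))) : ℝ) := by
  refine (integrable_exp_mul_exp_neg_norm_mul_cosh hd hl h h').mono (by fun_prop) ?_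
  refine Filter.Eventually.of_forall fun p => le_of_eq ?_
  simp [Complex.norm_exp, ← Complex.ofReal_add]

open MeasureTheory in
/-- The plane wave integral for real parameters, as an integral over one rapidity. -/
theorem integral_planeWave_real {d : ℕ} (hd : 0 < d) {l : ℂ} (hl : |l.re| < d / 2) {η η' : ℝ}
    (h : 0 < η) (h' : 0 < η') (w : EuclideanSpace ℝ (Fin d)) :
    ∫ p : EuclideanSpace ℝ (Fin d) × ℝ × ℝ,
      Complex.exp (Complex.I * (inner ℝ w p.1 : ℝ)) * Complex.exp (l * (p.2.1 + p.2.2)) *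
        (Real.exp (-(‖p.1‖ * (η * Real.cosh p.2.1 + η' * Real.cosh p.2.2))) : ℝ) =
    (((4 * Real.pi) ^ (d / 2 : ℝ) * Real.Gamma (d / 2) : ℝ) : ℂ) *
      ∫ u : ℝ, Complex.exp (l * u) *
        (((η ^ 2 + η' ^ 2 + 2 * η * η' * Real.cosh u + ‖w‖ ^ 2) ^ (-(d / 2 : ℝ)) : ℝ) : ℂ) := by
  rw [integral_shear (integrable_planeWave_real hd hl h h' w), ← integral_const_mul]
  congr 1
  ext u
  have hD : 0 < η ^ 2 + η' ^ 2 + 2 * η * η' * Real.cosh u := by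
    have := Real.cosh_pos u
    positivity
  have key := integral_gaussian_mixture hd hD w
  have hne : Nonempty (Fin d) := ⟨⟨0, hd⟩⟩
  have hae : ∀ᵐ k : EuclideanSpace ℝ (Fin d), k ≠ 0 := by simp [ae_iff]
  have hk : ∀ᵐ k : EuclideanSpace ℝ (Fin d),
      ∫ b : ℝ, Complex.exp (Complex.I * (inner ℝ w k : ℝ)) *
        Complex.exp (l * ((u - b : ℝ) + b)) *
        (Real.exp (-(‖k‖ * (η * Real.cosh (u - b) + η' * Real.cosh b))) : ℝ) =
      Complex.exp (l * u) * (Complex.exp (Complex.I * (inner ℝ w k : ℝ)) *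
      ((∫ q : ℝ, Real.exp (-((Real.exp q + (η ^ 2 + η' ^ 2 + 2 * η * η' * Real.cosh u) *
        ‖k‖ ^ 2 * Real.exp (-q)) / 2)) : ℝ) : ℂ)) := by
    filter_upwards [hae] with k hk
    rw [← integral_exp_neg_mul_cosh_add_cosh (norm_pos_iff.2 hk) h h' u]
    have : ∀ b : ℝ, ((u - b : ℝ) : ℂ) + b = u := fun b => by push_cast; ring
    simp only [this]
    rw [integral_const_mul, integral_complex_ofReal]
    ring
  rw [integral_congr_ae hk, integral_const_mul, key]
  push_cast
  ring

theorem Complex.ofReal_cpow_eq_exp_log {x : ℝ} (hx : 0 < x) (s : ℂ) :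
    (x : ℂ) ^ s = Complex.exp (Real.log x * s) := by
  rw [Complex.cpow_def_of_ne_zero (by exact_mod_cast hx.ne'), Complex.ofReal_log hx.le]

theorem euler_integrand_sigmoid {ρ : ℝ} (l : ℂ) {η η' B : ℝ} (h : 0 < η) (h' : 0 < η')
    (hB : 0 ≤ B) (u : ℝ) :
    |Real.sigmoid u * (1 - Real.sigmoid u)| • ((Real.sigmoid u : ℂ) ^ (ρ + l - 1) *
      (1 - (Real.sigmoid u : ℂ)) ^ (ρ - l - 1) *
      (1 - ((1 - ((η + η') ^ 2 + B) / (4 * η * η') : ℝ) : ℂ) *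
        ((4 * Real.sigmoid u * (1 - Real.sigmoid u) : ℝ) : ℂ)) ^ (-ρ : ℂ)) =
    (((η * η') ^ ρ : ℝ) : ℂ) * (Complex.exp (l * u) *
      (((η ^ 2 + η' ^ 2 + 2 * η * η' * Real.cosh u + B) ^ (-ρ) : ℝ) : ℂ)) := by
  have hx := Real.sigmoid_pos u
  have hy : 0 < 1 - Real.sigmoid u := by linarith [Real.sigmoid_lt_one u]
  have hu : u = Real.log (Real.sigmoid u) - Real.log (1 - Real.sigmoid u) := by
    rw [← Real.log_div hx.ne' hy.ne', ← Real.sigmoid_neg, ← Real.sigmoid_mul_rexp_neg,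
      div_mul_cancel_left₀ hx.ne', ← Real.exp_neg, neg_neg, Real.log_exp]
  have hcosh : Real.cosh u = (Real.sigmoid u ^ 2 + (1 - Real.sigmoid u) ^ 2) /
      (2 * (Real.sigmoid u * (1 - Real.sigmoid u))) := by
    have hu2 : Real.exp u = Real.sigmoid u / (1 - Real.sigmoid u) := by
      conv_lhs => rw [hu]
      rw [Real.exp_sub, Real.exp_log hx, Real.exp_log hy]
    rw [Real.cosh_eq, Real.exp_neg, hu2]
    field_simp
  rw [hcosh]
  have hl : Complex.exp (l * u) = Complex.exp (l * (Real.log (Real.sigmoid u) -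
      Real.log (1 - Real.sigmoid u))) := by
    conv_lhs => rw [hu]
    push_cast
    rfl
  rw [hl]
  clear hu hl hcosh
  generalize Real.sigmoid u = x at *
  set X := η ^ 2 + η' ^ 2 + 2 * η * η' * ((x ^ 2 + (1 - x) ^ 2) / (2 * (x * (1 - x)))) + B with hX
  have hX0 : 0 < X := by positivity
  set Y := 1 - (1 - ((η + η') ^ 2 + B) / (4 * η * η')) * (4 * x * (1 - x)) with hY
  have hXY : Y = X * (x * (1 - x)) / (η * η') := by
    rw [hX, hY]
    field_simp
    ring
  have hY0 : 0 < Y := by rw [hXY]; positivity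
  have hlogY : Real.log Y = Real.log X + (Real.log x + Real.log (1 - x)) - Real.log (η * η') := by
    rw [hXY, Real.log_div (by positivity) (by positivity), Real.log_mul (by positivity)
      (by positivity), Real.log_mul hx.ne' hy.ne']
  have hYc : 1 - ((1 - ((η + η') ^ 2 + B) / (4 * η * η') : ℝ) : ℂ) * ((4 * x * (1 - x) : ℝ) : ℂ) =
      (Y : ℂ) := by rw [hY]; push_cast; ring
  have hyc : 1 - (x : ℂ) = ((1 - x : ℝ) : ℂ) := by push_cast; ring
  rw [hYc, hyc, Complex.ofReal_cpow_eq_exp_log hx, Complex.ofReal_cpow_eq_exp_log hy,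
    Complex.ofReal_cpow_eq_exp_log hY0, Complex.ofReal_cpow (by positivity : 0 ≤ η * η'),
    Complex.ofReal_cpow hX0.le, Complex.ofReal_cpow_eq_exp_log (by positivity : 0 < η * η'),
    Complex.ofReal_cpow_eq_exp_log hX0, abs_of_pos (by positivity), hlogY, Complex.real_smul]
  nth_rewrite 1 [← Real.exp_log hx]
  nth_rewrite 1 [← Real.exp_log hy]
  push_cast
  simp only [← Complex.exp_add]
  congr 1
  ring

open MeasureTheory in
/-- Substitution of the sigmoid function in Euler's integral. -/
theorem integral_cosh_rpow_eq_eulerIntegral {ρ : ℝ} (l : ℂ) {η η' B : ℝ} (h : 0 < η) (h' : 0 < η')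
    (hB : 0 ≤ B) :
    ∫ u : ℝ, Complex.exp (l * u) *
      (((η ^ 2 + η' ^ 2 + 2 * η * η' * Real.cosh u + B) ^ (-ρ) : ℝ) : ℂ) =
    (((η * η') ^ (-ρ) : ℝ) : ℂ) *
      ∫ t in (0:ℝ)..1, (t:ℂ) ^ (ρ + l - 1) * (1 - (t:ℂ)) ^ (ρ - l - 1) *
        (1 - ((1 - ((η + η') ^ 2 + B) / (4 * η * η') : ℝ) : ℂ) *
          ((4 * t * (1 - t) : ℝ) : ℂ)) ^ (-ρ : ℂ) := by
  rw [intervalIntegral.integral_of_le zero_le_one, integral_Ioc_eq_integral_Ioo,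
    ← Real.range_sigmoid, ← Set.image_univ, integral_image_eq_integral_abs_deriv_smul
      MeasurableSet.univ (fun x _ => (Real.hasDerivAt_sigmoid x).hasDerivWithinAt)
      Real.sigmoid_injective.injOn, setIntegral_univ]
  simp only [euler_integrand_sigmoid l h h' hB]
  rw [integral_const_mul, ← mul_assoc, ← Complex.ofReal_mul, ← Real.rpow_add (by positivity)]
  simp

/-- The integrand of the plane wave expansion of the kernel. -/
noncomputable def planeWave {d : ℕ} (l η η' : ℂ) (β : Fin d → ℂ)
    (p : EuclideanSpace ℝ (Fin d) × ℝ × ℝ) : ℂ :=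
  Complex.exp (Complex.I * ∑ j, β j * (p.1 j : ℂ)) * Complex.exp (l * (p.2.1 + p.2.2)) *
    Complex.exp (-(‖p.1‖ * (η * (Real.cosh p.2.1 : ℝ) + η' * (Real.cosh p.2.2 : ℝ))))

/-- Euler's integral with the quadratically transformed kernel. -/
noncomputable def quadEulerIntegral (ρ : ℝ) (l z : ℂ) : ℂ :=
  ∫ t in (0:ℝ)..1, (t : ℂ) ^ (ρ + l - 1) * (1 - (t : ℂ)) ^ (ρ - l - 1) *
    (1 - z * ((4 * t * (1 - t) : ℝ) : ℂ)) ^ (-ρ : ℂ)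

theorem differentiableOn_quadEulerIntegral {ρ : ℝ} {l : ℂ} (hl : |l.re| < ρ) :
    DifferentiableOn ℂ (quadEulerIntegral ρ l) cutPlane := by
  have h := abs_lt.1 hl
  refine differentiableOn_eulerIntegral (φ := fun t => 4 * t * (1 - t)) ?_ (by fun_prop) ?_ (-ρ)
  · exact Complex.betaIntegral_convergent (by simp; linarith) (by simp; linarith)
  · rintro t ⟨h0, h1⟩
    exact ⟨by nlinarith, by nlinarith [sq_nonneg (2 * t - 1)]⟩

theorem continuous_planeWave {d : ℕ} (l η η' : ℂ) (β : Fin d → ℂ) :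
    Continuous (planeWave l η η' β) := by
  unfold planeWave
  fun_prop

theorem norm_planeWave_le {d : ℕ} {l η η' : ℂ} {β : Fin d → ℂ} {r₁ r₂ g : ℝ} (hg : 0 ≤ g)
    (h₁ : r₁ ≤ η.re) (h₂ : r₂ ≤ η'.re) (h : r₁ + r₂ + g ≤ η.re + η'.re)
    (hβ : ∑ j, (β j).im ^ 2 ≤ g ^ 2) (p : EuclideanSpace ℝ (Fin d) × ℝ × ℝ) :
    ‖planeWave l η η' β p‖ ≤ Real.exp (l.re * (p.2.1 + p.2.2)) *
      Real.exp (-(‖p.1‖ * (r₁ * Real.cosh p.2.1 + r₂ * Real.cosh p.2.2))) := by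
  obtain ⟨k, a, b⟩ := p
  have e1 : ‖Complex.exp (Complex.I * ∑ j, β j * (k j : ℂ))‖ =
      Real.exp (-∑ j, (β j).im * k j) := by
    rw [Complex.norm_exp]
    simp
  have e2 : ‖Complex.exp (l * (a + b))‖ = Real.exp (l.re * (a + b)) := by
    rw [← Complex.ofReal_add, Complex.norm_exp, Complex.re_mul_ofReal]
  have e3 : ‖Complex.exp (-(‖k‖ * (η * (Real.cosh a : ℝ) + η' * (Real.cosh b : ℝ))))‖ =
      Real.exp (-(‖k‖ * (η.re * Real.cosh a + η'.re * Real.cosh b))) := by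
    rw [Complex.norm_exp, Complex.neg_re, Complex.re_ofReal_mul, Complex.add_re,
      Complex.re_mul_ofReal, Complex.re_mul_ofReal]
  have hcs : -∑ j, (β j).im * k j ≤ g * ‖k‖ := by
    refine (neg_le_abs _).trans (abs_le_of_sq_le_sq ?_ (by positivity))
    calc (∑ j, (β j).im * k j) ^ 2 ≤ (∑ j, (β j).im ^ 2) * ∑ j, k j ^ 2 :=
          Finset.sum_mul_sq_le_sq_mul_sq _ _ _
      _ ≤ g ^ 2 * ∑ j, k j ^ 2 := by gcongr
      _ = _ := by rw [mul_pow, EuclideanSpace.real_norm_sq_eq]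
  have ha := Real.one_le_cosh a
  have hb := Real.one_le_cosh b
  have hc : g + r₁ * Real.cosh a + r₂ * Real.cosh b ≤ η.re * Real.cosh a + η'.re * Real.cosh b := by
    nlinarith
  simp only [planeWave, norm_mul, e1, e2, e3]
  rw [mul_comm (Real.exp _) (Real.exp (l.re * _)), mul_assoc, ← Real.exp_add]
  gcongr
  nlinarith [mul_le_mul_of_nonneg_left hc (norm_nonneg k)]

theorem exists_decay_rates {R₁ R₂ A : ℝ} (h₁ : 0 < R₁) (h₂ : 0 < R₂)
    (h : A < (R₁ + R₂) ^ 2) :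
    ∃ r₁ r₂ g : ℝ, 0 < r₁ ∧ 0 < r₂ ∧ 0 ≤ g ∧ r₁ < R₁ ∧ r₂ < R₂ ∧ r₁ + r₂ + g < R₁ + R₂ ∧
      A < g ^ 2 := by
  have hs : √A < R₁ + R₂ := (Real.sqrt_lt' (by positivity)).2 h
  obtain ⟨g, hg1, hg2⟩ := exists_between hs
  have hg0 : 0 ≤ g := (Real.sqrt_nonneg A).trans hg1.le
  have hR : 0 < R₁ + R₂ := by positivity
  set x := (R₁ + R₂ - g) / (2 * (R₁ + R₂)) with hx
  have hx0 : 0 < x := div_pos (by linarith) (by positivity)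
  have hx1 : x < 1 := by rw [hx, div_lt_one (by positivity)]; linarith
  have hx2 : x * (R₁ + R₂) = (R₁ + R₂ - g) / 2 := by rw [hx]; field_simp
  refine ⟨x * R₁, x * R₂, g, by positivity, by positivity, hg0, by nlinarith, by nlinarith,
    by nlinarith, ?_⟩
  rcases hg0.eq_or_lt with h0 | h0
  · exact absurd hg1 (by rw [← h0]; exact not_lt.2 (Real.sqrt_nonneg A))
  · exact (Real.sqrt_lt' h0).1 hg1

open MeasureTheory in
/-- The plane wave is integrable as long as the growth of its phase is beaten by its decay. -/
theorem integrable_planeWave {d : ℕ} (hd : 0 < d) {l η η' : ℂ} {β : Fin d → ℂ}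
    (hl : |l.re| < d / 2) (h : 0 < η.re) (h' : 0 < η'.re)
    (hβ : ∑ j, (β j).im ^ 2 < (η.re + η'.re) ^ 2) : Integrable (planeWave l η η' β) := by
  obtain ⟨r₁, r₂, g, h1, h2, hg, h3, h4, h5, h6⟩ :=
    exists_decay_rates h h' hβ
  exact (integrable_exp_mul_exp_neg_norm_mul_cosh hd hl h1 h2).mono'
    (continuous_planeWave _ _ _ _).aestronglyMeasurable
    (Filter.Eventually.of_forall (norm_planeWave_le hg h3.le h4.le h5.le h6.le))

open MeasureTheory in
theorem differentiableOn_integral_planeWave {d : ℕ} (hd : 0 < d) {l : ℂ} (hl : |l.re| < d / 2)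
    {U : Set ℂ} (hU : IsOpen U) {η η' : ℂ → ℂ} {β : ℂ → Fin d → ℂ} (hη : Differentiable ℂ η)
    (hη' : Differentiable ℂ η') (hβ : ∀ j, Differentiable ℂ fun w => β w j)
    (h : ∀ w ∈ U, 0 < (η w).re) (h' : ∀ w ∈ U, 0 < (η' w).re)
    (hb : ∀ w ∈ U, ∑ j, (β w j).im ^ 2 < ((η w).re + (η' w).re) ^ 2) :
    DifferentiableOn ℂ (fun w => ∫ p, planeWave l (η w) (η' w) (β w) p) U := by
  have cη := hη.continuous
  have cη' := hη'.continuous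
  have cβ := fun j => (hβ j).continuous
  refine differentiableOn_integral_of_dominated hU
    (fun w _ => (continuous_planeWave _ _ _ _).aestronglyMeasurable) ?_ ?_
  · refine Filter.Eventually.of_forall fun p => Differentiable.differentiableOn ?_
    unfold planeWave
    fun_prop
  · intro w₀ hw₀
    obtain ⟨r₁, r₂, g, h1, h2, hg, h3, h4, h5, h6⟩ :=
      exists_decay_rates (h w₀ hw₀) (h' w₀ hw₀) (hb w₀ hw₀)
    refine ⟨_, integrable_exp_mul_exp_neg_norm_mul_cosh hd hl h1 h2, ?_⟩
    have e1 : ∀ᶠ w in 𝓝 w₀, r₁ < (η w).re :=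
      (Complex.continuous_re.comp cη).continuousAt.eventually_const_lt h3
    have e2 : ∀ᶠ w in 𝓝 w₀, r₂ < (η' w).re :=
      (Complex.continuous_re.comp cη').continuousAt.eventually_const_lt h4
    have e3 : ∀ᶠ w in 𝓝 w₀, r₁ + r₂ + g < (η w).re + (η' w).re :=
      ((Complex.continuous_re.comp cη).add
        (Complex.continuous_re.comp cη')).continuousAt.eventually_const_lt h5
    have e4 : ∀ᶠ w in 𝓝 w₀, ∑ j, (β w j).im ^ 2 < g ^ 2 := by
      have : Continuous fun w => ∑ j, (β w j).im ^ 2 := continuous_finsetSum _ fun j _ =>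
        (Complex.continuous_im.comp (cβ j)).pow 2
      exact this.continuousAt.eventually_lt_const h6
    obtain ⟨r, hr, hball⟩ := Metric.eventually_nhds_iff_ball.1 (e1.and (e2.and (e3.and e4)))
    refine ⟨r, hr, Filter.Eventually.of_forall fun p w hw => ?_⟩
    obtain ⟨f1, f2, f3, f4⟩ := hball w hw
    exact norm_planeWave_le hg f1.le f2.le f3.le f4.le p

/-- The argument of the kernel avoids the cut `[1,∞)`. -/
theorem quadratic_ratio_mem_cutPlane {d : ℕ} {η η' : ℂ} {β : Fin d → ℂ} (h : 0 < η.re)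
    (h' : 0 < η'.re) (hβ : ∑ j, (β j).im ^ 2 < (η.re + η'.re) ^ 2) :
    1 - ((η + η') ^ 2 + ∑ j, β j ^ 2) / (4 * η * η') ∈ cutPlane := by
  have hη : η ≠ 0 := fun h0 => by simp [h0] at h
  have hη' : η' ≠ 0 := fun h0 => by simp [h0] at h'
  rw [cutPlane, Set.mem_ofPred_eq, sub_sub_cancel]
  by_contra hcon
  rw [Complex.mem_slitPlane_iff, not_or, not_lt, not_not] at hcon
  obtain ⟨hT, him⟩ := hcon
  set q := ((η + η') ^ 2 + ∑ j, β j ^ 2) / (4 * η * η') with hq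
  have hqr : q = (q.re : ℂ) := Complex.ext (by simp) (by simp [him])
  have key : (η + η') ^ 2 + ∑ j, β j ^ 2 = q.re * (4 * η * η') := by
    rw [← hqr, hq]
    field_simp
  have kr := congrArg Complex.re key
  have ki := congrArg Complex.im key
  have hcs := Finset.sum_mul_sq_le_sq_mul_sq Finset.univ (fun j => (β j).re) fun j => (β j).im
  have s1 : (∑ j, β j ^ 2).re = ∑ j, (β j).re ^ 2 - ∑ j, (β j).im ^ 2 := by
    rw [Complex.re_sum, ← Finset.sum_sub_distrib]
    exact Finset.sum_congr rfl fun j _ => by rw [sq, Complex.mul_re]; ring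
  have s2 : (∑ j, β j ^ 2).im = 2 * ∑ j, (β j).re * (β j).im := by
    rw [Complex.im_sum, Finset.mul_sum]
    exact Finset.sum_congr rfl fun j _ => by rw [sq, Complex.mul_im]; ring
  have hr0 : 0 ≤ ∑ j, (β j).re ^ 2 := Finset.sum_nonneg fun j _ => sq_nonneg _
  have hs0 : 0 ≤ ∑ j, (β j).im ^ 2 := Finset.sum_nonneg fun j _ => sq_nonneg _
  simp only [Complex.add_re, Complex.add_im, s1, s2, sq (η + η'), Complex.mul_re, Complex.mul_im,
    Complex.ofReal_re, Complex.ofReal_im] at kr ki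
  norm_num at kr ki
  clear_value q
  generalize (∑ j, (β j).re ^ 2) = r at *
  generalize (∑ j, (β j).im ^ 2) = s at *
  generalize (∑ j, (β j).re * (β j).im) = m at *
  generalize q.re = T at *
  obtain ⟨a, a'⟩ := η
  obtain ⟨b, b'⟩ := η'
  simp only at *
  obtain ⟨C, hC⟩ : ∃ C, C = 1 - 2 * T := ⟨_, rfl⟩
  have hC1 : 1 ≤ C := by linarith
  have k1 : a ^ 2 + b ^ 2 + 2 * C * (a * b) + r = a' ^ 2 + b' ^ 2 + 2 * C * (a' * b') + s := by
    rw [hC]; linarith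
  have k2 : a * a' + b * b' + C * (a * b' + a' * b) = -m := by
    rw [hC]; linarith
  have hu : s < a ^ 2 + b ^ 2 + 2 * C * (a * b) := by nlinarith [mul_pos h h']
  have rev : (a ^ 2 + b ^ 2 + 2 * C * (a * b)) * (a' ^ 2 + b' ^ 2 + 2 * C * (a' * b')) ≤ m ^ 2 := by
    have e : m ^ 2 - (a ^ 2 + b ^ 2 + 2 * C * (a * b)) * (a' ^ 2 + b' ^ 2 + 2 * C * (a' * b')) =
        (C ^ 2 - 1) * (a * b' - a' * b) ^ 2 := by
      rw [show m = -(a * a' + b * b' + C * (a * b' + a' * b)) by linarith]; ring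
    have : 0 ≤ (C ^ 2 - 1) * (a * b' - a' * b) ^ 2 :=
      mul_nonneg (by nlinarith) (sq_nonneg _)
    linarith
  generalize a ^ 2 + b ^ 2 + 2 * C * (a * b) = u at *
  have hq' : a' ^ 2 + b' ^ 2 + 2 * C * (a' * b') = u + r - s := by linarith
  rw [hq'] at rev
  nlinarith [mul_pos (sub_pos.2 hu) (show 0 < u + r by linarith)]

theorem convex_setOf_affine_pos (p q r : ℝ) : Convex ℝ {w : ℂ | 0 < p + q * w.re + r * w.im} := by
  intro x hx y hy a b ha hb hab
  simp only [Set.mem_ofPred_eq, Complex.add_re, Complex.add_im, Complex.real_smul,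
    Complex.re_ofReal_mul, Complex.im_ofReal_mul] at *
  have e : p + q * (a * x.re + b * y.re) + r * (a * x.im + b * y.im) =
      a * (p + q * x.re + r * x.im) + b * (p + q * y.re + r * y.im) := by
    linear_combination (-p) * hab
  rw [e]
  rcases ha.eq_or_lt with rfl | ha
  · rw [zero_add] at hab; subst hab; simpa using hy
  · have := mul_pos ha hx
    have := mul_nonneg hb hy.le
    linarith

theorem isOpen_setOf_affine_pos (p q r : ℝ) : IsOpen {w : ℂ | 0 < p + q * w.re + r * w.im} :=
  isOpen_lt continuous_const (by fun_prop)

open MeasureTheory in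
theorem integral_planeWave_ofReal {d : ℕ} (hd : 0 < d) {ρ : ℝ} (hρ : ρ = d / 2) {l : ℂ}
    (hl : |l.re| < ρ) {η η' : ℝ} (h : 0 < η) (h' : 0 < η') (β : Fin d → ℝ) :
    ∫ p, planeWave l η η' (fun j => (β j : ℂ)) p =
      (((4 * Real.pi) ^ ρ * Real.Gamma ρ : ℝ) : ℂ) *
        ((η : ℂ) ^ (-ρ : ℂ) * (η' : ℂ) ^ (-ρ : ℂ) * quadEulerIntegral ρ l
          (1 - ((η + η' : ℂ) ^ 2 + ∑ j, (β j : ℂ) ^ 2) / (4 * η * η'))) := by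
  subst hρ
  have key := integral_planeWave_real hd hl h h' (WithLp.toLp 2 β)
  rw [integral_cosh_rpow_eq_eulerIntegral l h h' (sq_nonneg _)] at key
  have hfun : ∀ p, planeWave l η η' (fun j => (β j : ℂ)) p =
      Complex.exp (Complex.I * (inner ℝ (WithLp.toLp 2 β) p.1 : ℝ)) *
        Complex.exp (l * (p.2.1 + p.2.2)) *
        (Real.exp (-(‖p.1‖ * (η * Real.cosh p.2.1 + η' * Real.cosh p.2.2))) : ℝ) := by
    intro p
    have : inner ℝ (WithLp.toLp 2 β) p.1 = ∑ j, β j * p.1 j := by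
      simp [PiLp.inner_apply, mul_comm]
    rw [this]
    simp only [planeWave]
    push_cast
    rfl
  simp only [hfun]
  rw [key, EuclideanSpace.real_norm_sq_eq, Real.mul_rpow h.le h'.le]
  congr 1
  rw [quadEulerIntegral]
  push_cast [Complex.ofReal_cpow h.le, Complex.ofReal_cpow h'.le]
  rfl

open MeasureTheory in
/-- The integral of a plane wave, obtained from real parameters by analytic continuation. -/
theorem integral_planeWave {d : ℕ} (hd : 0 < d) {ρ : ℝ} (hρ : ρ = d / 2) {l : ℂ}
    (hl : |l.re| < ρ) {η η' : ℂ} {β : Fin d → ℂ} (h : 0 < η.re) (h' : 0 < η'.re)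
    (hβ : ∑ j, (β j).im ^ 2 < (η.re + η'.re) ^ 2) :
    ∫ p, planeWave l η η' β p =
      (((4 * Real.pi) ^ ρ * Real.Gamma ρ : ℝ) : ℂ) *
        (η ^ (-ρ : ℂ) * η' ^ (-ρ : ℂ) * quadEulerIntegral ρ l
          (1 - ((η + η') ^ 2 + ∑ j, β j ^ 2) / (4 * η * η'))) := by
  have hA : 0 ≤ ∑ j, (β j).im ^ 2 := Finset.sum_nonneg fun j _ => sq_nonneg _
  have hs : √(∑ j, (β j).im ^ 2) < η.re + η'.re := (Real.sqrt_lt' (by positivity)).2 hβ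
  set A := √(∑ j, (β j).im ^ 2) with hAdef
  have hA2 : A ^ 2 = ∑ j, (β j).im ^ 2 := Real.sq_sqrt hA
  set f : ℂ → ℂ := fun w => η.re + w * η.im with hf
  set f' : ℂ → ℂ := fun w => η'.re + w * η'.im with hf'
  set B : ℂ → Fin d → ℂ := fun w j => (β j).re + w * (β j).im with hB
  set W : Set ℂ := {w | 0 < η.re + η.im * w.re + 0 * w.im} ∩
    {w | 0 < η'.re + η'.im * w.re + 0 * w.im} ∩
    ({w | 0 < (η.re + η'.re) + (η.im + η'.im) * w.re + A * w.im} ∩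
    {w | 0 < (η.re + η'.re) + (η.im + η'.im) * w.re + (-A) * w.im}) with hW
  have hWo : IsOpen W := ((isOpen_setOf_affine_pos _ _ _).inter (isOpen_setOf_affine_pos _ _ _)).inter
    ((isOpen_setOf_affine_pos _ _ _).inter (isOpen_setOf_affine_pos _ _ _))
  have hWc : Convex ℝ W := ((convex_setOf_affine_pos _ _ _).inter
    (convex_setOf_affine_pos _ _ _)).inter
    ((convex_setOf_affine_pos _ _ _).inter (convex_setOf_affine_pos _ _ _))
  have w1 : ∀ w ∈ W, 0 < (f w).re := fun w hw => by
    have : 0 < η.re + η.im * w.re + 0 * w.im := hw.1.1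
    simp only [hf, Complex.add_re, Complex.ofReal_re, Complex.re_mul_ofReal]
    linarith
  have w2 : ∀ w ∈ W, 0 < (f' w).re := fun w hw => by
    have : 0 < η'.re + η'.im * w.re + 0 * w.im := hw.1.2
    simp only [hf', Complex.add_re, Complex.ofReal_re, Complex.re_mul_ofReal]
    linarith
  have w3 : ∀ w ∈ W, ∑ j, (B w j).im ^ 2 < ((f w).re + (f' w).re) ^ 2 := fun w hw => by
    have h1 : 0 < (η.re + η'.re) + (η.im + η'.im) * w.re + A * w.im := hw.2.1
    have h2 : 0 < (η.re + η'.re) + (η.im + η'.im) * w.re + (-A) * w.im := hw.2.2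
    have e : ∑ j, (B w j).im ^ 2 = (A * w.im) ^ 2 := by
      rw [mul_pow, hA2, Finset.sum_mul]
      refine Finset.sum_congr rfl fun j _ => ?_
      simp only [hB, Complex.add_im, Complex.ofReal_im, Complex.im_mul_ofReal]
      ring
    rw [e]
    simp only [hf, hf', Complex.add_re, Complex.ofReal_re, Complex.re_mul_ofReal]
    exact sq_lt_sq' (by linarith) (by linarith)
  have hL : DifferentiableOn ℂ (fun w => ∫ p, planeWave l (f w) (f' w) (B w) p) W :=
    differentiableOn_integral_planeWave hd (hρ ▸ hl) hWo (by fun_prop) (by fun_prop)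
      (fun j => by fun_prop) w1 w2 w3
  have hR : DifferentiableOn ℂ (fun w => (((4 * Real.pi) ^ ρ * Real.Gamma ρ : ℝ) : ℂ) *
      (f w ^ (-ρ : ℂ) * f' w ^ (-ρ : ℂ) * quadEulerIntegral ρ l
          (1 - ((f w + f' w) ^ 2 + ∑ j, B w j ^ 2) / (4 * f w * f' w)))) W := by
    have df : DifferentiableOn ℂ f W := by fun_prop
    have df' : DifferentiableOn ℂ f' W := by fun_prop
    refine DifferentiableOn.const_mul (((df.cpow_const fun w hw => Or.inl (w1 w hw)).mul
      (df'.cpow_const fun w hw => Or.inl (w2 w hw))).mul ?_) _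
    refine (differentiableOn_quadEulerIntegral hl).comp (f := fun w =>
      1 - ((f w + f' w) ^ 2 + ∑ j, B w j ^ 2) / (4 * f w * f' w)) ?_
      fun w hw => quadratic_ratio_mem_cutPlane (w1 w hw) (w2 w hw) (w3 w hw)
    refine DifferentiableOn.const_sub (DifferentiableOn.div ?_ (by fun_prop) ?_) _
    · simp only [hB]
      fun_prop
    · intro w hw
      have n1 : f w ≠ 0 := fun h0 => by have := w1 w hw; simp [h0] at this
      have n2 : f' w ≠ 0 := fun h0 => by have := w2 w hw; simp [h0] at this
      exact mul_ne_zero (mul_ne_zero (by norm_num) n1) n2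
  have h0W : (0 : ℂ) ∈ W := by
    have : 0 < η.re + η'.re := by positivity
    simp [hW, h, h', this]
  have hIW : Complex.I ∈ W := by
    have := Real.sqrt_nonneg (∑ j, (β j).im ^ 2)
    simp only [hW, Set.mem_inter_iff, Set.mem_ofPred_eq, Complex.I_re, Complex.I_im]
    refine ⟨⟨?_, ?_⟩, ?_, ?_⟩ <;> linarith
  have hfreq : ∃ᶠ w in 𝓝[≠] (0 : ℂ), ∫ p, planeWave l (f w) (f' w) (B w) p =
      (((4 * Real.pi) ^ ρ * Real.Gamma ρ : ℝ) : ℂ) *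
      (f w ^ (-ρ : ℂ) * f' w ^ (-ρ : ℂ) * quadEulerIntegral ρ l
          (1 - ((f w + f' w) ^ 2 + ∑ j, B w j ^ 2) / (4 * f w * f' w))) := by
    have ht : Tendsto (fun x : ℝ => (x : ℂ)) (𝓝[≠] 0) (𝓝[≠] 0) := by
      refine tendsto_nhdsWithin_iff.2 ⟨?_, ?_⟩
      · exact (Complex.continuous_ofReal.tendsto' 0 0 rfl).mono_left nhdsWithin_le_nhds
      · filter_upwards [self_mem_nhdsWithin] with x hx
        simpa using hx
    refine ht.frequently (Filter.Eventually.frequently ?_)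
    have hev : ∀ᶠ x : ℝ in 𝓝 0, (x : ℂ) ∈ W :=
      Complex.continuous_ofReal.continuousAt.eventually_mem (by simpa using hWo.mem_nhds h0W)
    filter_upwards [hev.filter_mono nhdsWithin_le_nhds] with x hx
    have p1 := w1 x hx
    have p2 := w2 x hx
    have r1 : f x = ((η.re + x * η.im : ℝ) : ℂ) := by simp [hf]
    have r2 : f' x = ((η'.re + x * η'.im : ℝ) : ℂ) := by simp [hf']
    have r3 : B x = fun j => (((β j).re + x * (β j).im : ℝ) : ℂ) := by ext j; simp [hB]
    rw [r1, Complex.ofReal_re] at p1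
    rw [r2, Complex.ofReal_re] at p2
    rw [r1, r2, r3]
    exact integral_planeWave_ofReal hd hρ hl p1 p2 _
  have := (hL.analyticOnNhd hWo).eqOn_of_preconnected_of_frequently_eq (hR.analyticOnNhd hWo)
    hWc.isPreconnected h0W hfreq hIW
  have i1 : f Complex.I = η := by simp only [hf]; rw [mul_comm]; exact Complex.re_add_im η
  have i2 : f' Complex.I = η' := by simp only [hf']; rw [mul_comm]; exact Complex.re_add_im η'
  have i3 : B Complex.I = β := by
    ext j
    simp only [hB]
    rw [mul_comm]
    exact Complex.re_add_im _
  simpa only [i1, i2, i3] using this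

section

open scoped ComplexConjugate

/-- The `k`-component of the plane wave attached to a point with coordinates `(η, b)`. -/
noncomputable def waveFactor {d : ℕ} (l η : ℂ) (b : Fin d → ℂ) (k : EuclideanSpace ℝ (Fin d)) : ℂ :=
  Complex.exp (Complex.I * ∑ j, b j * (k j : ℂ)) *
    ∫ a : ℝ, Complex.exp (l * a) * Complex.exp (-(‖k‖ * (η * (Real.cosh a : ℝ))))

open MeasureTheory in
theorem conj_integral_exp_cosh {l : ℂ} (hl : conj l = l ∨ conj l = -l) (s η : ℂ) :
    conj (∫ a : ℝ, Complex.exp (l * a) * Complex.exp (-(s * (η * (Real.cosh a : ℝ))))) =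
      ∫ a : ℝ, Complex.exp (l * a) * Complex.exp (-(conj s * (conj η * (Real.cosh a : ℝ)))) := by
  rw [← integral_conj]
  simp only [map_mul, ← Complex.exp_conj, map_neg, Complex.conj_ofReal]
  rcases hl with h | h
  · rw [h]
  · rw [h, ← integral_neg_eq_self]
    simp

open MeasureTheory in
theorem integral_planeWave_eq_integral_waveFactor {d : ℕ} (hd : 0 < d) {l η η' : ℂ}
    {b b' : Fin d → ℂ} (hl : |l.re| < d / 2) (hl' : conj l = l ∨ conj l = -l) (h : 0 < η.re)
    (h' : 0 < η'.re) (hβ : ∑ j, (b j - conj (b' j)).im ^ 2 < (η.re + (conj η').re) ^ 2) :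
    Integrable (fun k => waveFactor l η b k * conj (waveFactor l η' b' k)) ∧
    ∫ p, planeWave l η (conj η') (fun j => b j - conj (b' j)) p =
      ∫ k, waveFactor l η b k * conj (waveFactor l η' b' k) := by
  have hint := integrable_planeWave hd hl h (by simpa using h') hβ
  have hk : ∀ k : EuclideanSpace ℝ (Fin d),
      ∫ q : ℝ × ℝ, planeWave l η (conj η') (fun j => b j - conj (b' j)) (k, q) =
        waveFactor l η b k * conj (waveFactor l η' b' k) := by
    intro k
    have e : ∀ q : ℝ × ℝ, planeWave l η (conj η') (fun j => b j - conj (b' j)) (k, q) =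
        Complex.exp (Complex.I * ∑ j, b j * (k j : ℂ)) *
          conj (Complex.exp (Complex.I * ∑ j, b' j * (k j : ℂ))) *
        ((Complex.exp (l * q.1) * Complex.exp (-(‖k‖ * (η * (Real.cosh q.1 : ℝ))))) *
          (Complex.exp (l * q.2) * Complex.exp (-(‖k‖ * (conj η' * (Real.cosh q.2 : ℝ)))))) := by
      intro q
      simp only [planeWave, ← Complex.exp_conj, ← Complex.exp_add, map_mul, map_sum,
        Complex.conj_ofReal, Complex.conj_I, sub_mul, Finset.sum_sub_distrib]
      congr 1
      ring
    have hc := conj_integral_exp_cosh hl' (‖k‖ : ℂ) η'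
    rw [Complex.conj_ofReal] at hc
    simp only [e]
    rw [integral_const_mul, waveFactor, waveFactor, map_mul, hc, Measure.volume_eq_prod,
      integral_prod_mul (μ := volume) (ν := volume)
        (fun a : ℝ => Complex.exp (l * a) * Complex.exp (-(‖k‖ * (η * (Real.cosh a : ℝ)))))
        (fun a : ℝ => Complex.exp (l * a) *
          Complex.exp (-(‖k‖ * (conj η' * (Real.cosh a : ℝ)))))]
    ring
  have h1 : Integrable (fun k => ∫ q : ℝ × ℝ,
    planeWave l η (conj η') (fun j => b j - conj (b' j)) (k, q)) := hint.integral_prod_left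
  refine ⟨?_, ?_⟩
  · simpa only [hk] using h1
  · rw [Measure.volume_eq_prod, integral_prod _ hint]
    simp only [hk]

theorem sum_sq_add_lt {ι : Type*} [Fintype ι] {x y : ι → ℝ} {R S : ℝ} (hR : 0 < R) (hS : 0 < S)
    (hx : ∑ i, x i ^ 2 < R ^ 2) (hy : ∑ i, y i ^ 2 < S ^ 2) :
    ∑ i, (x i + y i) ^ 2 < (R + S) ^ 2 := by
  have hcs := Finset.sum_mul_sq_le_sq_mul_sq Finset.univ x y
  have hx0 : 0 ≤ ∑ i, x i ^ 2 := Finset.sum_nonneg fun i _ => sq_nonneg _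
  have hy0 : 0 ≤ ∑ i, y i ^ 2 := Finset.sum_nonneg fun i _ => sq_nonneg _
  have h1 : ∑ i, x i * y i ≤ R * S := by
    refine (le_abs_self _).trans (abs_le_of_sq_le_sq ?_ (by positivity))
    rw [mul_pow]
    exact hcs.trans (mul_le_mul hx.le hy.le hy0 (sq_nonneg R))
  have e : ∑ i, (x i + y i) ^ 2 = ∑ i, x i ^ 2 + 2 * ∑ i, x i * y i + ∑ i, y i ^ 2 := by
    rw [Finset.mul_sum, ← Finset.sum_add_distrib, ← Finset.sum_add_distrib]
    exact Finset.sum_congr rfl fun i _ => by ring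
  rw [e]
  linarith [add_sq R S]

open MeasureTheory in
/-- Positive definiteness of the kernel given by plane wave integrals: it is a Gram kernel. -/
theorem sum_integral_planeWave_nonneg {d : ℕ} (hd : 0 < d) {l : ℂ} (hl : |l.re| < d / 2)
    (hl' : conj l = l ∨ conj l = -l) {ι : Type*} [Fintype ι] {η : ι → ℂ} {b : ι → Fin d → ℂ}
    (h : ∀ i, 0 < (η i).re) (hb : ∀ i, ∑ a, (b i a).im ^ 2 < (η i).re ^ 2) (c : ι → ℂ) :
    ∃ x : ℝ, 0 ≤ x ∧ ∑ i, ∑ j, c i * conj (c j) *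
      ∫ p, planeWave l (η i) (conj (η j)) (fun a => b i a - conj (b j a)) p = x := by
  have hβ : ∀ i j, ∑ a, (b i a - conj (b j a)).im ^ 2 < ((η i).re + (conj (η j)).re) ^ 2 := by
    intro i j
    simpa using sum_sq_add_lt (h i) (h j) (hb i) (hb j)
  have key := fun i j => integral_planeWave_eq_integral_waveFactor hd hl hl' (h i) (h j) (hβ i j)
  refine ⟨∫ k, Complex.normSq (∑ i, c i * waveFactor l (η i) (b i) k),
    integral_nonneg fun k => Complex.normSq_nonneg _, ?_⟩
  rw [← integral_complex_ofReal]
  have e : ∀ k, ((Complex.normSq (∑ i, c i * waveFactor l (η i) (b i) k) : ℝ) : ℂ) =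
      ∑ i, ∑ j, c i * conj (c j) *
        (waveFactor l (η i) (b i) k * conj (waveFactor l (η j) (b j) k)) := by
    intro k
    rw [← Complex.mul_conj, map_sum, Finset.sum_mul_sum]
    refine Finset.sum_congr rfl fun i _ => Finset.sum_congr rfl fun j _ => ?_
    rw [map_mul]
    ring
  simp only [e]
  rw [integral_finsetSum _ fun i _ => integrable_finsetSum _ fun j _ => (key i j).1.const_mul _]
  refine Finset.sum_congr rfl fun i _ => ?_
  rw [integral_finsetSum _ fun j _ => (key i j).1.const_mul _]
  refine Finset.sum_congr rfl fun j _ => ?_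
  rw [integral_const_mul, (key i j).2]

theorem lformC_mulVec {n : ℕ} {g : Matrix (Fin (n + 1)) (Fin (n + 1)) ℝ} (hg : memG n g)
    (z w : Fin (n + 1) → ℂ) :
    lformC n ((g.map Complex.ofReal).mulVec z) ((g.map Complex.ofReal).mulVec w) =
      lformC n z w := by
  have hdot : ∀ z w : Fin (n + 1) → ℂ,
      lformC n z w = z ⬝ᵥ ((eta n).map Complex.ofReal).mulVec w := by
    intro z w
    have hm : (eta n).map Complex.ofReal =
        Matrix.diagonal fun i : Fin (n + 1) => if i = 0 then (-1 : ℂ) else 1 := by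
      rw [eta, Matrix.diagonal_map Complex.ofReal_zero]
      congr 1
      ext i
      split_ifs <;> simp
    simp only [hm, Matrix.mulVec_diagonal, dotProduct, lformC]
    exact Finset.sum_congr rfl fun i _ => by ring
  have hC : (g.map Complex.ofReal).transpose * (eta n).map Complex.ofReal *
      g.map Complex.ofReal = (eta n).map Complex.ofReal := by
    have := congrArg (fun M => Matrix.map M Complex.ofRealHom) hg.1
    simp only [Matrix.map_mul] at this
    exact this
  rw [hdot z w, ← hC, hdot, ← Matrix.mulVec_mulVec, ← Matrix.mulVec_mulVec,
    Matrix.dotProduct_mulVec z, Matrix.vecMul_transpose]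

theorem lformC_self_of_mem_Snplus {n : ℕ} {w : Fin (n + 1) → ℂ} (hw : w ∈ Snplus n) :
    lformC n w w = 1 := by
  obtain ⟨x, -, hx, h0, hi⟩ := hw
  have hx' : ∑ i, (x i : ℂ) ^ 2 = 1 := by exact_mod_cast hx
  refine (Finset.sum_congr rfl fun i _ => ?_).trans hx'
  rcases eq_or_ne i 0 with rfl | h
  · rw [h0, if_pos rfl]
    linear_combination (-(x 0 : ℂ) ^ 2) * Complex.I_sq
  · rw [hi i h, if_neg h]
    ring

theorem sum_sq_column_zero {n : ℕ} {g : Matrix (Fin (n + 1)) (Fin (n + 1)) ℝ} (hg : memG n g) :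
    ∑ i : Fin n, g i.succ 0 ^ 2 = g 0 0 ^ 2 - 1 := by
  have h := congrFun (congrFun hg.1 0) 0
  rw [Matrix.mul_apply] at h
  simp only [eta, Matrix.mul_diagonal, Matrix.transpose_apply,
    Fin.sum_univ_succ, Matrix.diagonal_apply_eq, if_true, Fin.succ_ne_zero, if_false] at h
  have e : ∑ i : Fin n, g i.succ 0 ^ 2 = ∑ i : Fin n, g i.succ 0 * 1 * g i.succ 0 :=
    Finset.sum_congr rfl fun i _ => by ring
  rw [e]
  linarith

/-- A point of the crown has Lorentzian square one, and its imaginary part is future timelike. -/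
theorem Xi_subset {n : ℕ} {z : Fin (n + 1) → ℂ} (hz : z ∈ Xi n) :
    lformC n z z = 1 ∧ 0 < (z 0).im ∧ ∑ i : Fin n, (z i.succ).im ^ 2 < (z 0).im ^ 2 := by
  obtain ⟨g, w, hg, hw, rfl⟩ := hz
  refine ⟨by rw [lformC_mulVec hg, lformC_self_of_mem_Snplus hw], ?_⟩
  obtain ⟨x, hx0, -, h0, hi⟩ := hw
  have him : ∀ i, ((g.map Complex.ofReal).mulVec w i).im = g i 0 * x 0 := by
    intro i
    simp [Matrix.mulVec, dotProduct, Fin.sum_univ_succ, h0, hi _ (Fin.succ_ne_zero _)]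
  simp only [him, mul_pow, ← Finset.sum_mul, sum_sq_column_zero hg]
  exact ⟨mul_pos hg.2.2 hx0, mul_lt_mul_of_pos_right (by linarith) (by positivity)⟩

theorem lformC_succ {d : ℕ} (z w : Fin (d + 1 + 1) → ℂ) :
    lformC (d + 1) z w = -(z 0 * w 0) + z (Fin.last _) * w (Fin.last _) +
      ∑ j : Fin d, z j.castSucc.succ * w j.castSucc.succ := by
  simp only [lformC, Fin.sum_univ_succ (n := d + 1), Fin.succ_ne_zero, if_true, if_false,
    Fin.sum_univ_castSucc (n := d), Fin.succ_last]
  simp only [one_mul, neg_mul]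
  ring

/-- The horospherical coordinate `i / (z₀ + zₙ)`. -/
noncomputable def horoHeight {d : ℕ} (z : Fin (d + 1 + 1) → ℂ) : ℂ :=
  Complex.I / (z 0 + z (Fin.last _))

/-- The horospherical coordinates `z_j / (z₀ + zₙ)`, `1 ≤ j < n`. -/
noncomputable def horoPosition {d : ℕ} (z : Fin (d + 1 + 1) → ℂ) (j : Fin d) : ℂ :=
  z j.castSucc.succ / (z 0 + z (Fin.last _))

theorem sum_im_div_sq_lt {ι : Type*} [Fintype ι] {p q : ℂ} {v : ι → ℂ} (hp : 0 < p.im)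
    (hv : ∑ j, v j ^ 2 = 1 + p * q) (him : ∑ j, (v j).im ^ 2 < p.im * q.im) :
    ∑ j, (v j / p).im ^ 2 < (Complex.I / p).re ^ 2 := by
  have hN : 0 < Complex.normSq p := Complex.normSq_pos.2 fun h => by simp [h] at hp
  have hre := congrArg Complex.re hv
  have him' := congrArg Complex.im hv
  simp only [Complex.re_sum, Complex.im_sum, sq, Complex.mul_re, Complex.mul_im, Complex.add_re,
    Complex.add_im, Complex.one_re, Complex.one_im, Finset.sum_sub_distrib,
    Finset.sum_add_distrib] at hre him'
  have e : ∑ j, (v j / p).im ^ 2 = (p.re ^ 2 * ∑ j, (v j).im * (v j).im -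
      p.re * p.im * (∑ j, (v j).re * (v j).im + ∑ j, (v j).im * (v j).re) +
      p.im ^ 2 * ∑ j, (v j).re * (v j).re) / Complex.normSq p ^ 2 := by
    rw [← Finset.sum_add_distrib, Finset.mul_sum, Finset.mul_sum, Finset.mul_sum,
      ← Finset.sum_sub_distrib, ← Finset.sum_add_distrib, Finset.sum_div]
    refine Finset.sum_congr rfl fun j _ => ?_
    rw [Complex.div_im]
    field_simp
    ring
  have e' : (Complex.I / p).re = p.im / Complex.normSq p := by simp [Complex.div_re]
  rw [e, e', div_pow]
  refine div_lt_div_of_pos_right ?_ (by positivity)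
  simp only [sq] at him ⊢
  rw [him', show ∑ j, (v j).re * (v j).re =
    1 + (p.re * q.re - p.im * q.im) + ∑ j, (v j).im * (v j).im by linarith]
  rw [Complex.normSq_apply] at hN
  nlinarith [mul_pos hN (sub_pos.2 him)]

theorem horo_mem {d : ℕ} {z : Fin (d + 1 + 1) → ℂ} (hz : z ∈ Xi (d + 1)) :
    0 < (z 0 + z (Fin.last _)).im ∧ 0 < (horoHeight z).re ∧
      ∑ j, (horoPosition z j).im ^ 2 < (horoHeight z).re ^ 2 := by
  obtain ⟨h1, h0, h2⟩ := Xi_subset hz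
  rw [lformC_succ] at h1
  rw [Fin.sum_univ_castSucc, Fin.succ_last] at h2
  have hs : 0 ≤ ∑ j : Fin d, (z j.castSucc.succ).im ^ 2 := Finset.sum_nonneg fun _ _ => sq_nonneg _
  have hp : 0 < (z 0 + z (Fin.last _)).im := by
    rw [Complex.add_im]
    have := abs_lt_of_sq_lt_sq (show (z (Fin.last (d + 1))).im ^ 2 < (z 0).im ^ 2 by
      linarith) h0.le
    linarith [(abs_lt.1 this).1]
  refine ⟨hp, ?_, ?_⟩
  · have : 0 < Complex.normSq (z 0 + z (Fin.last _)) :=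
      Complex.normSq_pos.2 fun h => by simp [h] at hp
    have e : (horoHeight z).re = (z 0 + z (Fin.last _)).im /
        Complex.normSq (z 0 + z (Fin.last _)) := by
      simp only [horoHeight, Complex.div_re, Complex.I_re, Complex.I_im]
      ring
    rw [e]
    positivity
  · refine sum_im_div_sq_lt (q := z 0 - z (Fin.last _)) hp ?_ ?_
    · simp only [sq]
      linear_combination h1
    · rw [Complex.add_im, Complex.sub_im]
      linarith

/-- The Lorentzian form on the crown in horospherical coordinates. -/
theorem lformC_eq_horo {d : ℕ} {z w : Fin (d + 1 + 1) → ℂ} (hz : z ∈ Xi (d + 1))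
    (hw : w ∈ Xi (d + 1)) :
    (1 + lformC (d + 1) z (conjVec (d + 1) w)) / 2 =
      1 - ((horoHeight z + conj (horoHeight w)) ^ 2 +
        ∑ j, (horoPosition z j - conj (horoPosition w j)) ^ 2) /
          (4 * horoHeight z * conj (horoHeight w)) := by
  have hp : z 0 + z (Fin.last _) ≠ 0 := fun h => by simpa [h] using (horo_mem hz).1
  have hq : conj (w 0) + conj (w (Fin.last _)) ≠ 0 := by
    rw [← map_add]
    exact (map_ne_zero _).2 fun h => by simpa [h] using (horo_mem hw).1
  have h1 := (Xi_subset hz).1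
  have h2 := congrArg conj (Xi_subset hw).1
  rw [lformC_succ] at h1 h2
  simp only [map_add, map_neg, map_mul, map_sum, map_one] at h2
  have e : ∑ j, (horoPosition z j - conj (horoPosition w j)) ^ 2 =
      (∑ j : Fin d, z j.castSucc.succ * z j.castSucc.succ) / (z 0 + z (Fin.last _)) ^ 2 -
      2 * (∑ j : Fin d, z j.castSucc.succ * conj (w j.castSucc.succ)) /
        ((z 0 + z (Fin.last _)) * (conj (w 0) + conj (w (Fin.last _)))) +
      (∑ j : Fin d, conj (w j.castSucc.succ) * conj (w j.castSucc.succ)) /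
        (conj (w 0) + conj (w (Fin.last _))) ^ 2 := by
    rw [Finset.mul_sum, Finset.sum_div, Finset.sum_div, Finset.sum_div, ← Finset.sum_sub_distrib,
      ← Finset.sum_add_distrib]
    refine Finset.sum_congr rfl fun j _ => ?_
    simp only [horoPosition, map_div₀, map_add]
    field_simp
    ring
  rw [e, lformC_succ]
  simp only [conjVec, horoHeight, map_div₀, map_add, Complex.conj_I]
  rw [show ∑ j : Fin d, z j.castSucc.succ * z j.castSucc.succ =
      1 + z 0 * z 0 - z (Fin.last _) * z (Fin.last _) by linear_combination h1,
    show ∑ j : Fin d, conj (w j.castSucc.succ) * conj (w j.castSucc.succ) =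
      1 + conj (w 0) * conj (w 0) - conj (w (Fin.last _)) * conj (w (Fin.last _)) by
        linear_combination h2]
  have hI : Complex.I ^ 2 = -1 := Complex.I_sq
  have hI0 : Complex.I ≠ 0 := Complex.I_ne_zero
  generalize Complex.I = I at *
  generalize (∑ j : Fin d, z j.castSucc.succ * conj (w j.castSucc.succ)) = V
  generalize z 0 = a at *
  generalize z (Fin.last _) = b at *
  generalize conj (w 0) = a' at *
  generalize conj (w (Fin.last _)) = b' at *
  have hden : 4 * (I / (a + b)) * (-I / (a' + b')) = 4 / ((a + b) * (a' + b')) := by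
    field_simp
    linear_combination -hI
  have hnum : (I / (a + b) + -I / (a' + b')) ^ 2 = -(1 / (a + b) - 1 / (a' + b')) ^ 2 := by
    field_simp
    linear_combination (a' + b' - (a + b)) ^ 2 * hI
  rw [hden, hnum]
  field_simp
  ring

theorem admissible.re_nonneg {n : ℕ} {l : ℂ} (h : admissible n l) : 0 ≤ l.re := by
  rcases h with ⟨h, -⟩ | ⟨-, h, -⟩
  · exact h.ge
  · exact h.le

theorem admissible.re_lt {d : ℕ} (hd : 0 < d) {l : ℂ} (h : admissible (d + 1) l) :
    l.re < (d : ℝ) / 2 := by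
  have : (0 : ℝ) < d := Nat.cast_pos.2 hd
  rcases h with ⟨h, -⟩ | ⟨-, -, h⟩
  · rw [h]
    positivity
  · push_cast at h
    linarith

theorem admissible.conj_eq {n : ℕ} {l : ℂ} (h : admissible n l) : conj l = l ∨ conj l = -l := by
  rcases h with ⟨h, -⟩ | ⟨h, -⟩
  · exact Or.inr (Complex.ext (by simp [h]) (by simp))
  · exact Or.inl (Complex.ext (by simp) (by simp [h]))

theorem Flam_eq_quadEulerIntegral {d : ℕ} (hd : 0 < d) {l : ℂ} (hl : admissible (d + 1) l) {z : ℂ}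
    (hz : z ∈ cutPlane) :
    Flam (d + 1) l z = Complex.Gamma (2 * ((d / 2 : ℝ) : ℂ)) /
      (Complex.Gamma (((d / 2 : ℝ) : ℂ) + l) * Complex.Gamma (((d / 2 : ℝ) : ℂ) - l)) *
        quadEulerIntegral (d / 2) l z := by
  have h := euler_quadratic_transformation (ρ := (d / 2 : ℝ)) (by positivity) hl.re_nonneg
    (hl.re_lt hd) hz
  rw [quadEulerIntegral, ← h, Flam,
    show ((((d + 1 : ℕ) : ℂ) - 1) / 2) = ((d / 2 : ℝ) : ℂ) by push_cast; ring,
    show (((d + 1 : ℕ) : ℂ) / 2) = ((d / 2 : ℝ) : ℂ) + 1 / 2 by push_cast; ring]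

theorem exists_pos_eq_Gamma_quotient {ρ : ℝ} {l : ℂ} (h0 : 0 ≤ l.re) (h1 : l.re < ρ)
    (hl : conj l = l ∨ conj l = -l) :
    ∃ x : ℝ, 0 < x ∧ Complex.Gamma (2 * (ρ : ℂ)) /
      (Complex.Gamma ((ρ : ℂ) + l) * Complex.Gamma ((ρ : ℂ) - l)) = x := by
  have hG : Complex.Gamma (2 * (ρ : ℂ)) = (Real.Gamma (2 * ρ) : ℂ) := by
    rw [← Complex.Gamma_ofReal]
    push_cast
    rfl
  have hG0 : 0 < Real.Gamma (2 * ρ) := Real.Gamma_pos_of_pos (by linarith)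
  rcases hl with hl | hl
  · obtain ⟨r, rfl⟩ := Complex.conj_eq_iff_real.1 hl
    rw [Complex.ofReal_re] at h0 h1
    have hp : 0 < Real.Gamma (ρ + r) := Real.Gamma_pos_of_pos (by linarith)
    have hm : 0 < Real.Gamma (ρ - r) := Real.Gamma_pos_of_pos (by linarith)
    refine ⟨Real.Gamma (2 * ρ) / (Real.Gamma (ρ + r) * Real.Gamma (ρ - r)), by positivity, ?_⟩
    rw [hG, ← Complex.ofReal_add, ← Complex.ofReal_sub, Complex.Gamma_ofReal,
      Complex.Gamma_ofReal]
    push_cast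
    rfl
  · have hc : Complex.Gamma ((ρ : ℂ) - l) = conj (Complex.Gamma ((ρ : ℂ) + l)) := by
      rw [← Complex.Gamma_conj, map_add, Complex.conj_ofReal, hl, sub_eq_add_neg]
    have hne : Complex.Gamma ((ρ : ℂ) + l) ≠ 0 := Complex.Gamma_ne_zero_of_re_pos (by
      simp only [Complex.add_re, Complex.ofReal_re]
      linarith)
    have := Complex.normSq_pos.2 hne
    refine ⟨Real.Gamma (2 * ρ) / Complex.normSq (Complex.Gamma ((ρ : ℂ) + l)), by positivity, ?_⟩
    rw [hc, Complex.mul_conj, hG, Complex.ofReal_div]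

/-- On the crown, the kernel is a positive multiple of a Gram-type matrix of plane-wave integrals,
up to a diagonal change of the coefficients. -/
theorem Flam_eq_integral_planeWave {d : ℕ} (hd : 0 < d) {l : ℂ} (hl : admissible (d + 1) l) :
    ∃ C : ℝ, 0 < C ∧ ∀ z ∈ Xi (d + 1), ∀ w ∈ Xi (d + 1),
      Flam (d + 1) l ((1 + lformC (d + 1) z (conjVec (d + 1) w)) / 2) =
        C * (horoHeight z ^ (((d / 2 : ℝ) : ℂ)) * conj (horoHeight w ^ (((d / 2 : ℝ) : ℂ))) *
          ∫ p, planeWave l (horoHeight z) (conj (horoHeight w))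
            (fun j => horoPosition z j - conj (horoPosition w j)) p) := by
  have hd' : (0 : ℝ) < d / 2 := by positivity
  obtain ⟨x, hx, hG⟩ := exists_pos_eq_Gamma_quotient hl.re_nonneg (hl.re_lt hd) hl.conj_eq
  have hK : (0 : ℝ) < (4 * Real.pi) ^ (d / 2 : ℝ) * Real.Gamma (d / 2) :=
    mul_pos (by positivity) (Real.Gamma_pos_of_pos hd')
  refine ⟨x / ((4 * Real.pi) ^ (d / 2 : ℝ) * Real.Gamma (d / 2)), div_pos hx hK,
    fun z hz w hw => ?_⟩
  obtain ⟨-, hηz, hbz⟩ := horo_mem hz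
  obtain ⟨-, hηw, hbw⟩ := horo_mem hw
  have hηw' : 0 < (conj (horoHeight w)).re := by simpa using hηw
  have hβ : ∑ j, (horoPosition z j - conj (horoPosition w j)).im ^ 2 <
      ((horoHeight z).re + (conj (horoHeight w)).re) ^ 2 := by
    simpa using sum_sq_add_lt hηz hηw hbz hbw
  have hz0 : horoHeight z ≠ 0 := fun h => by simp [h] at hηz
  have hw0 : horoHeight w ≠ 0 := fun h => by simp [h] at hηw
  have harg : (horoHeight w).arg ≠ Real.pi := fun h =>
    (Complex.arg_eq_pi_iff.1 h).1.not_gt hηw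
  have hconj : conj (horoHeight w ^ (((d / 2 : ℝ) : ℂ))) =
      conj (horoHeight w) ^ (((d / 2 : ℝ) : ℂ)) := by
    rw [Complex.conj_cpow _ _ harg, Complex.conj_ofReal]
  rw [lformC_eq_horo hz hw, Flam_eq_quadEulerIntegral hd hl
      (quadratic_ratio_mem_cutPlane hηz hηw' hβ),
    integral_planeWave hd rfl (abs_lt.2 ⟨by linarith [hl.re_nonneg], hl.re_lt hd⟩) hηz hηw' hβ, hG,
    hconj, Complex.cpow_neg, Complex.cpow_neg, Complex.ofReal_div]
  have h1 := (Complex.cpow_ne_zero_iff_of_exponent_ne_zero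
    (Complex.ofReal_ne_zero.2 hd'.ne')).2 hz0
  have h2 := (Complex.cpow_ne_zero_iff_of_exponent_ne_zero
    (Complex.ofReal_ne_zero.2 hd'.ne')).2 ((map_ne_zero conj).2 hw0)
  have hK' := Complex.ofReal_ne_zero.2 hK.ne'
  field_simp

end

theorem stmt5 (n : ℕ) (hn : 2 ≤ n) (lam : ℂ) (hlam : admissible n lam)
    (m : ℕ) (z : Fin m → (Fin (n+1) → ℂ)) (hz : ∀ i, z i ∈ Xi n) (c : Fin m → ℂ) :
    (∑ i, ∑ j, c i * (starRingEnd ℂ) (c j) *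
      Flam n lam ((1 + lformC n (z i) (conjVec n (z j)))/2)).im = 0 ∧
    0 ≤ (∑ i, ∑ j, c i * (starRingEnd ℂ) (c j) *
      Flam n lam ((1 + lformC n (z i) (conjVec n (z j)))/2)).re := by
  obtain ⟨d, rfl⟩ : ∃ d, n = d + 1 := ⟨n - 1, by omega⟩
  have hd : 0 < d := by omega
  obtain ⟨C, hC, hF⟩ := Flam_eq_integral_planeWave hd hlam
  obtain ⟨x, hx, hsum⟩ := sum_integral_planeWave_nonneg hd
    (abs_lt.2 ⟨by linarith [hlam.re_nonneg, hlam.re_lt hd], hlam.re_lt hd⟩) hlam.conj_eq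
    (fun i => (horo_mem (hz i)).2.1) (fun i => (horo_mem (hz i)).2.2)
    (fun i => c i * horoHeight (z i) ^ (((d / 2 : ℝ) : ℂ)))
  have key : ∑ i, ∑ j, c i * (starRingEnd ℂ) (c j) *
      Flam (d + 1) lam ((1 + lformC (d + 1) (z i) (conjVec (d + 1) (z j)))/2) =
        ((C * x : ℝ) : ℂ) := by
    rw [Complex.ofReal_mul, ← hsum, Finset.mul_sum]
    refine Finset.sum_congr rfl fun i _ => ?_
    rw [Finset.mul_sum]
    refine Finset.sum_congr rfl fun j _ => ?_
    rw [hF _ (hz i) _ (hz j), map_mul]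
    ring
  rw [key]
  exact ⟨Complex.ofReal_im _, by
    rw [Complex.ofReal_re]
    positivity⟩
end

section
/- Let n ≥ 2, ρ = (n−1)/2, and let λ be either purely imaginary with nonnegative imaginary part or real with 0 < λ < ρ. For every z ∈ Ξ and every w ∈ Ξ ∪ dS^n, the number (1+[z, conj w])/2 lies in ℂ∖[1,∞), and the map (z,w) ↦ F_λ((1+[z, conj w])/2) is continuous on the set Ξ × (Ξ ∪ dS^n) ⊂ ℂ^{1+n} × ℂ^{1+n}; i.e. the kernel Ψ_λ extends continuously from Ξ × Ξ to Ξ × (Ξ ∪ dS^n). -/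
open scoped BigOperators
open Filter Topology

/-! ### The Lorentzian form -/

lemma lformR_eq_sub (n : ℕ) (x y : Fin (n+1) → ℝ) :
    lformR n x y = ∑ i : Fin n, x i.succ * y i.succ - x 0 * y 0 := by
  simp only [lformR, Fin.sum_univ_succ, Fin.succ_ne_zero, if_true, if_false]
  simp only [one_mul]
  ring

lemma lformR_eq_dotProduct (n : ℕ) (x y : Fin (n+1) → ℝ) :
    lformR n x y = x ⬝ᵥ (eta n).mulVec y := by
  simp only [lformR, eta, dotProduct, Matrix.mulVec_diagonal]
  exact Finset.sum_congr rfl fun i _ => by ring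

lemma lformR_mulVec {n : ℕ} {g : Matrix (Fin (n+1)) (Fin (n+1)) ℝ} (hg : memG n g)
    (x y : Fin (n+1) → ℝ) : lformR n (g.mulVec x) (g.mulVec y) = lformR n x y := by
  rw [lformR_eq_dotProduct, lformR_eq_dotProduct]
  conv_rhs => rw [← hg.1]
  rw [← Matrix.mulVec_mulVec, ← Matrix.mulVec_mulVec, Matrix.dotProduct_mulVec x,
    Matrix.vecMul_transpose]

lemma lformC_re (n : ℕ) (z w : Fin (n+1) → ℂ) :
    (lformC n z w).re = lformR n (fun i => (z i).re) (fun i => (w i).re) -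
      lformR n (fun i => (z i).im) (fun i => (w i).im) := by
  simp only [lformC, lformR, Complex.re_sum, ← Finset.sum_sub_distrib]
  refine Finset.sum_congr rfl fun i _ => ?_
  split_ifs
  · simp; ring
  · simp

lemma lformC_im (n : ℕ) (z w : Fin (n+1) → ℂ) :
    (lformC n z w).im = lformR n (fun i => (z i).re) (fun i => (w i).im) +
      lformR n (fun i => (z i).im) (fun i => (w i).re) := by
  simp only [lformC, lformR, Complex.im_sum, ← Finset.sum_add_distrib]
  refine Finset.sum_congr rfl fun i _ => ?_
  split_ifs
  · simp; ring
  · simp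

lemma lformC_sub_sub (n : ℕ) (z w : Fin (n+1) → ℂ) :
    lformC n (z - w) (z - w) = lformC n z z + lformC n w w - 2 * lformC n z w := by
  simp only [lformC, Finset.mul_sum, ← Finset.sum_sub_distrib, ← Finset.sum_add_distrib]
  refine Finset.sum_congr rfl fun i _ => ?_
  simp only [Pi.sub_apply]
  ring

lemma lformC_conjVec (n : ℕ) (z w : Fin (n+1) → ℂ) :
    lformC n (conjVec n z) (conjVec n w) = (starRingEnd ℂ) (lformC n z w) := by
  simp only [lformC, conjVec, map_sum, map_mul]
  refine Finset.sum_congr rfl fun i _ => ?_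
  split_ifs <;> simp

/-! ### The forward light cone -/

/-- The open forward light cone in `ℝ^{1+n}`. -/
def forwardCone (n : ℕ) : Set (Fin (n+1) → ℝ) :=
  {y | 0 < y 0 ∧ lformR n y y < 0}

lemma add_mem_forwardCone {n : ℕ} {x y : Fin (n+1) → ℝ} (hx : x ∈ forwardCone n)
    (hy : y ∈ forwardCone n) : x + y ∈ forwardCone n := by
  obtain ⟨hx0, hx⟩ := hx
  obtain ⟨hy0, hy⟩ := hy
  refine ⟨add_pos hx0 hy0, ?_⟩
  rw [lformR_eq_sub] at *
  have hcs := Finset.sum_mul_sq_le_sq_mul_sq Finset.univ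
    (fun i : Fin n => x i.succ) (fun i => y i.succ)
  have hX : 0 ≤ ∑ i : Fin n, x i.succ ^ 2 := Finset.sum_nonneg fun i _ => sq_nonneg _
  have hY : 0 ≤ ∑ i : Fin n, y i.succ ^ 2 := Finset.sum_nonneg fun i _ => sq_nonneg _
  have hexp : ∑ i : Fin n, (x + y) i.succ * (x + y) i.succ = ∑ i : Fin n, x i.succ ^ 2 +
      ∑ i : Fin n, y i.succ ^ 2 + 2 * ∑ i : Fin n, x i.succ * y i.succ := by
    simp only [Finset.mul_sum, ← Finset.sum_add_distrib, Pi.add_apply]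
    exact Finset.sum_congr rfl fun i _ => by ring
  simp only [← pow_two] at hx hy
  rw [hexp, Pi.add_apply]
  have hxy : ∑ i : Fin n, x i.succ * y i.succ ≤ x 0 * y 0 := by
    refine le_of_sq_le_sq ?_ (mul_pos hx0 hy0).le
    rw [mul_pow]
    exact hcs.trans (mul_le_mul (by linarith) (by linarith) hY (sq_nonneg _))
  nlinarith

/-- A vector orthogonal to a timelike one is not timelike. -/
lemma lformR_self_nonneg_of_orthogonal {n : ℕ} {p q : Fin (n+1) → ℝ}
    (hq : q ∈ forwardCone n) (hpq : lformR n p q = 0) : 0 ≤ lformR n p p := by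
  obtain ⟨hq0, hq⟩ := hq
  rw [lformR_eq_sub] at *
  have hcs := Finset.sum_mul_sq_le_sq_mul_sq Finset.univ
    (fun i : Fin n => p i.succ) (fun i => q i.succ)
  have hP : 0 ≤ ∑ i : Fin n, p i.succ ^ 2 := Finset.sum_nonneg fun i _ => sq_nonneg _
  simp only [← pow_two] at hq ⊢
  rw [sub_eq_zero.mp hpq, mul_pow] at hcs
  have hle : p 0 ^ 2 * q 0 ^ 2 ≤ (∑ i : Fin n, p i.succ ^ 2) * q 0 ^ 2 :=
    hcs.trans (mul_le_mul_of_nonneg_left (by linarith) hP)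
  have := le_of_mul_le_mul_right hle (pow_pos hq0 2)
  linarith

/-! ### The crown -/

lemma lformC_self_of_mem_Xi {n : ℕ} {z : Fin (n+1) → ℂ} (hz : z ∈ Xi n) :
    lformC n z z = 1 ∧ (fun i => (z i).im) ∈ forwardCone n := by
  obtain ⟨g, w, hg, ⟨x, hx0, hx, hw0, hw⟩, rfl⟩ := hz
  have hre : (fun i => ((g.map Complex.ofReal).mulVec w i).re) =
      g.mulVec fun i => (w i).re := by
    ext i; simp [Matrix.mulVec, dotProduct]
  have him : (fun i => ((g.map Complex.ofReal).mulVec w i).im) =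
      g.mulVec fun i => (w i).im := by
    ext i; simp [Matrix.mulVec, dotProduct]
  have hwim : ∀ i : Fin n, (w i.succ).im = 0 := fun i => by simp [hw _ i.succ_ne_zero]
  have hwre : ∀ i : Fin n, (w i.succ).re = x i.succ := fun i => by simp [hw _ i.succ_ne_zero]
  rw [Fin.sum_univ_succ] at hx
  refine ⟨Complex.ext ?_ ?_, ?_, ?_⟩
  · rw [lformC_re, hre, him, lformR_mulVec hg, lformR_mulVec hg, lformR_eq_sub, lformR_eq_sub]
    simp [hw0, hwim, hwre, ← pow_two]
    linarith
  · rw [lformC_im, hre, him, lformR_mulVec hg, lformR_mulVec hg, lformR_eq_sub, lformR_eq_sub]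
    simp [hw0, hwim, hwre]
  · rw [him]
    simpa [Matrix.mulVec, dotProduct, Fin.sum_univ_succ, hwim, hw0] using mul_pos hg.2.2 hx0
  · rw [him, lformR_mulVec hg, lformR_eq_sub]
    simpa [hwim, hw0] using hx0.ne'

/-- The kernel argument avoids the cut. -/
lemma one_add_lformC_div_two_notMem_slit {n : ℕ} {z w : Fin (n+1) → ℂ} (hz : z ∈ Xi n)
    (hw : w ∈ Xi n ∪ dSC n) : (1 + lformC n z (conjVec n w))/2 ∉ slit := by
  obtain ⟨hzz, hzim⟩ := lformC_self_of_mem_Xi hz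
  have hww : lformC n w w = 1 := hw.elim (fun h => (lformC_self_of_mem_Xi h).1) fun h => h.2
  have hq : (fun i => ((z - conjVec n w) i).im) ∈ forwardCone n := by
    rcases hw with hw | hw
    · convert add_mem_forwardCone hzim (lformC_self_of_mem_Xi hw).2 using 1
      ext i; simp [conjVec]
    · convert hzim using 1
      ext i; simp [conjVec, hw.1 i]
  have hsub := lformC_sub_sub n z (conjVec n w)
  rw [hzz, lformC_conjVec, hww] at hsub
  rintro ⟨him, hre⟩
  have hre' : 1 ≤ (lformC n z (conjVec n w)).re := by
    simp at hre; linarith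
  have him' : (lformC n z (conjVec n w)).im = 0 := by simpa using him
  have h1 := congrArg Complex.re hsub
  have h2 := congrArg Complex.im hsub
  have hcomm : ∀ x y, lformR n x y = lformR n y x := fun x y => by
    simp only [lformR_eq_sub, mul_comm]
  rw [lformC_re] at h1
  rw [lformC_im, hcomm (fun i => ((z - conjVec n w) i).im)] at h2
  simp [him'] at h1 h2
  have := lformR_self_nonneg_of_orthogonal hq h2
  have hq2 := hq.2
  simp at this hq2
  linarith

/-! ### Continuity of Euler's integral -/

lemma isClosed_slit : IsClosed slit :=
  (isClosed_eq Complex.continuous_im continuous_const).inter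
    (isClosed_le continuous_const Complex.continuous_re)

lemma one_sub_mul_mem_slitPlane {z : ℂ} (hz : z ∉ slit) {t : ℝ} (ht : t ∈ Set.Icc (0:ℝ) 1) :
    1 - z * (t : ℂ) ∈ Complex.slitPlane := by
  by_contra h
  simp only [Complex.mem_slitPlane_iff, not_or, not_lt, not_not] at h
  obtain ⟨h1, h2⟩ := h
  simp at h1 h2
  have ht0 : t ≠ 0 := by
    rintro rfl
    norm_num at h1
  have hzim : z.im = 0 := by simpa [ht0] using h2
  have htpos : 0 < t := lt_of_le_of_ne ht.1 (Ne.symm ht0)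
  refine hz ⟨hzim, ?_⟩
  by_contra hlt
  nlinarith [ht.2]

/-- Euler's integral is continuous in its argument off the cut `[1,∞)`. -/
lemma continuousAt_eulerIntegral {a b : ℂ} (c : ℂ) (ha : 0 < a.re) (hb : 0 < b.re) {z₀ : ℂ}
    (hz₀ : z₀ ∉ slit) :
    ContinuousAt (fun z : ℂ => ∫ t in (0:ℝ)..1, (t : ℂ) ^ (a - 1) *
      ((1 : ℂ) - (t : ℂ)) ^ (b - 1) * ((1 : ℂ) - z * (t : ℂ)) ^ c) z₀ := by
  obtain ⟨r, hr, hball⟩ := Metric.nhds_basis_closedBall.mem_iff.mp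
    (isClosed_slit.isOpen_compl.mem_nhds hz₀)
  have hcont : ContinuousOn (fun p : ℂ × ℝ => ((1 : ℂ) - p.1 * (p.2 : ℂ)) ^ c)
      (Metric.closedBall z₀ r ×ˢ Set.Icc (0:ℝ) 1) :=
    ContinuousOn.cpow_const (by fun_prop)
      fun p hp => one_sub_mul_mem_slitPlane (hball hp.1) hp.2
  obtain ⟨C, hC⟩ :=
    ((isCompact_closedBall z₀ r).prod isCompact_Icc).exists_bound_of_continuousOn hcont
  have hbeta := Complex.betaIntegral_convergent ha hb
  have hIoc : Set.uIoc (0:ℝ) 1 ⊆ Set.Icc 0 1 := by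
    rw [Set.uIoc_of_le zero_le_one]
    exact Set.Ioc_subset_Icc_self
  have hnhds : ∀ᶠ z in 𝓝 z₀, z ∈ Metric.closedBall z₀ r := Metric.closedBall_mem_nhds z₀ hr
  refine intervalIntegral.continuousAt_of_dominated_interval
    (bound := fun t => ‖(t : ℂ) ^ (a - 1) * ((1 : ℂ) - (t : ℂ)) ^ (b - 1)‖ * C) ?_ ?_
    (hbeta.norm.mul_const C) ?_
  · filter_upwards [hnhds] with z hz
    refine hbeta.def'.aestronglyMeasurable.mul
      (ContinuousOn.aestronglyMeasurable ?_ measurableSet_uIoc)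
    exact hcont.comp (f := fun t : ℝ => (z, t)) (by fun_prop) fun t ht => ⟨hz, hIoc ht⟩
  · filter_upwards [hnhds] with z hz
    refine Filter.Eventually.of_forall fun t ht => ?_
    rw [norm_mul]
    exact mul_le_mul_of_nonneg_left (hC (z, t) ⟨hz, hIoc ht⟩) (norm_nonneg _)
  · refine Filter.Eventually.of_forall fun t ht => continuousAt_const.mul ?_
    exact ContinuousAt.cpow (by fun_prop) continuousAt_const
      (one_sub_mul_mem_slitPlane hz₀ (hIoc ht))

lemma continuousAt_Flam {n : ℕ} (hn : 2 ≤ n) {lam : ℂ} (hlam : admissible n lam) {z : ℂ}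
    (hz : z ∉ slit) : ContinuousAt (Flam n lam) z := by
  have hn' : (2:ℝ) ≤ n := by exact_mod_cast hn
  have hlam' : 0 ≤ lam.re ∧ lam.re < ((n : ℝ) - 1)/2 := by
    rcases hlam with h | h
    · exact ⟨h.1.ge, by rw [h.1]; linarith⟩
    · exact ⟨h.2.1.le, h.2.2⟩
  have ha : 0 < (((n : ℂ) - 1)/2 - lam).re := by
    simpa using hlam'.2
  have hb : 0 < (lam + 1/2).re := by
    have : (lam + 1/2).re = lam.re + 1/2 := by simp
    rw [this]; linarith [hlam'.1]
  have h := continuousAt_eulerIntegral (-(((n : ℂ) - 1)/2) - lam) ha hb hz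
  rw [show lam + 1/2 - 1 = lam - 1/2 by ring] at h
  exact continuousAt_const.mul h

theorem stmt7 (n : ℕ) (hn : 2 ≤ n) (lam : ℂ) (hlam : admissible n lam) :
    (∀ z ∈ Xi n, ∀ w ∈ Xi n ∪ dSC n, (1 + lformC n z (conjVec n w))/2 ∉ slit) ∧
    ContinuousOn (fun p : (Fin (n+1) → ℂ) × (Fin (n+1) → ℂ) =>
        Flam n lam ((1 + lformC n p.1 (conjVec n p.2))/2))
      ((Xi n) ×ˢ (Xi n ∪ dSC n)) := by
  refine ⟨fun z hz w hw => one_add_lformC_div_two_notMem_slit hz hw, fun p hp => ?_⟩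
  refine ContinuousAt.continuousWithinAt ?_
  refine ContinuousAt.comp (f := fun p : (Fin (n+1) → ℂ) × (Fin (n+1) → ℂ) =>
    (1 + lformC n p.1 (conjVec n p.2))/2)
    (continuousAt_Flam hn hlam (one_add_lformC_div_two_notMem_slit hp.1 hp.2)) ?_
  unfold lformC conjVec
  have := Complex.continuous_conj
  fun_prop
end
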